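/- arXiv:cs/0612015 — 4 statements merged into one kernel-verified Lean document; each statement's English description precedes it below -/
import Mathlib

section
/- Let C₁ and C₂ be additive codes, i.e. additive subgroups of Z₂^α × Z₄^β. Then the additive subgroup generated by the union of their additive duals equals the additive dual of their intersection: ⟨C₁^⊥, C₂^⊥⟩ = (C₁ ∩ C₂)^⊥. -/
open scoped BigOperators

/-- `Z2` is the ring of integers modulo 2. -/
abbrev Z2 : Type := ZMod 2

/-- `Z4` is the ring of integers modulo 4. -/
abbrev Z4 : Type := ZMod 4

/-- The ambient group `Z₂^α × Z₄^β` for additive codes. -/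
abbrev Amb (α β : ℕ) : Type := (Fin α → Z2) × (Fin β → Z4)

/-- The inner product on `Z₂^α × Z₄^β`:
`⟨u,v⟩ = 2·(Σᵢ ūᵢ·v̄ᵢ) + Σⱼ uⱼ·vⱼ ∈ Z₄`, where the bar denotes the lift `0 ↦ 0`, `1 ↦ 1`
of binary coordinates into `Z₄`. -/
def addInner {α β : ℕ} (u v : Amb α β) : Z4 :=
  2 * (∑ i, ((u.1 i).val : Z4) * ((v.1 i).val : Z4)) + ∑ j, u.2 j * v.2 j

lemma addInner_zero_left {α β : ℕ} (v : Amb α β) : addInner 0 v = 0 := by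
  simp [addInner]

lemma addInner_add_left {α β : ℕ} (u u' v : Amb α β) :
    addInner (u + u') v = addInner u v + addInner u' v := by
  have key : ∀ x x' y : Z2,
      (2 : Z4) * ((((x + x').val : ℕ) : Z4) * ((y.val : ℕ) : Z4)) =
        2 * (((x.val : ℕ) : Z4) * ((y.val : ℕ) : Z4)) +
          2 * (((x'.val : ℕ) : Z4) * ((y.val : ℕ) : Z4)) := by decide
  simp only [addInner, Prod.fst_add, Prod.snd_add, Pi.add_apply, add_mul,
    Finset.mul_sum, Finset.sum_add_distrib]
  rw [Finset.sum_congr rfl (fun i _ => key (u.1 i) (u'.1 i) (v.1 i)),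
    Finset.sum_add_distrib]
  ring

lemma addInner_neg_left {α β : ℕ} (u v : Amb α β) :
    addInner (-u) v = - addInner u v := by
  have hn : ∀ x : Z2, (-x) = x := by decide
  have key : ∀ S T : Z4, 2 * S + -T = -(2 * S + T) := by decide
  simp only [addInner, Prod.fst_neg, Prod.snd_neg, Pi.neg_apply, hn, neg_mul]
  rw [Finset.sum_neg_distrib]
  exact key _ _

/-- The additive dual `C^⊥ = {u : ⟨u,v⟩ = 0 for all v ∈ C}` of an additive code `C`. -/
def dualCode {α β : ℕ} (C : AddSubgroup (Amb α β)) : AddSubgroup (Amb α β) where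
  carrier := {u | ∀ v ∈ C, addInner u v = 0}
  zero_mem' := fun v _ => addInner_zero_left v
  add_mem' := by
    intro a b ha hb v hv
    rw [addInner_add_left, ha v hv, hb v hv, add_zero]
  neg_mem' := by
    intro a ha v hv
    rw [addInner_neg_left, ha v hv, neg_zero]

/-- An additive code `C ⊆ Z₂^α × Z₄^β` is of type `(α,β;γ,δ)` when it is isomorphic,
as an abelian group, to `Z₂^γ × Z₄^δ`; equivalently (which is how we state it),
`|C| = 2^(γ+2δ)` and the number of elements `x ∈ C` with `x + x = 0` is `2^(γ+δ)`. -/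
def isOfType {α β : ℕ} (C : AddSubgroup (Amb α β)) (γ δ : ℕ) : Prop :=
  Nat.card C = 2 ^ (γ + 2 * δ) ∧
    Nat.card {x : Amb α β // x ∈ C ∧ x + x = 0} = 2 ^ (γ + δ)

/-- An additive code `C` is of type `(α,β;γ,δ;κ)` when it is of type `(α,β;γ,δ)` and
`2^κ` is the cardinality of the image of `{x ∈ C : x + x = 0}` under the projection
onto the binary coordinates. -/
def isOfTypeK {α β : ℕ} (C : AddSubgroup (Amb α β)) (γ δ κ : ℕ) : Prop :=
  isOfType C γ δ ∧
    Nat.card ↥(Prod.fst '' {x : Amb α β | x ∈ C ∧ x + x = 0}) = 2 ^ κ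

/-- The Gray map on one quaternary coordinate:
`0 ↦ (0,0)`, `1 ↦ (0,1)`, `2 ↦ (1,1)`, `3 ↦ (1,0)`. -/
def grayPhi (y : Z4) : Z2 × Z2 :=
  if y = 0 then (0, 0) else if y = 1 then (0, 1) else if y = 2 then (1, 1) else (1, 0)

/-- The Gray map `Φ : Z₂^α × Z₄^β → Z₂^(α+2β)` (with index set `Fin α ⊕ Fin β × Fin 2`),
acting as the identity on the binary coordinates and as `grayPhi` coordinatewise on the
quaternary coordinates. -/
def grayMap {α β : ℕ} (u : Amb α β) : (Fin α ⊕ Fin β × Fin 2) → Z2 :=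
  Sum.elim (fun a => u.1 a)
    (fun b => if b.2 = 0 then (grayPhi (u.2 b.1)).1 else (grayPhi (u.2 b.1)).2)

/-- The minimum Hamming distance of a binary code `S` equals `d`. -/
def minDistEq {ι : Type} [Fintype ι] (S : Set (ι → Z2)) (d : ℕ) : Prop :=
  (∀ x ∈ S, ∀ y ∈ S, x ≠ y → d ≤ hammingDist x y) ∧
    ∃ x ∈ S, ∃ y ∈ S, x ≠ y ∧ hammingDist x y = d

/-- A quaternary linear perfect code of length `β = 2^(t-1)` (`t ≥ 3`): an additive
subgroup of `Z₄^β` whose Gray image has cardinality `2^(2β-t-1)` and minimum Hamming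
distance `4`. -/
def isQuatPerfect (t β : ℕ) (C : AddSubgroup (Amb 0 β)) : Prop :=
  3 ≤ t ∧ β = 2 ^ (t - 1) ∧
    Nat.card ↥(grayMap '' (C : Set (Amb 0 β))) = 2 ^ (2 * β - t - 1) ∧
    minDistEq (grayMap '' (C : Set (Amb 0 β))) 4

/-- An additive extended perfect code with `α ≠ 0` and binary length `α + 2β = 2^t`:
an additive subgroup of `Z₂^α × Z₄^β` with `α ≥ 1` whose Gray image has cardinality
`2^(2^t - t - 1)` and minimum Hamming distance `4`. -/
def isAddExtPerfect (t α β : ℕ) (C : AddSubgroup (Amb α β)) : Prop :=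
  1 ≤ α ∧ α + 2 * β = 2 ^ t ∧
    Nat.card ↥(grayMap '' (C : Set (Amb α β))) = 2 ^ (2 ^ t - t - 1) ∧
    minDistEq (grayMap '' (C : Set (Amb α β))) 4

lemma addInner_comm {α β : ℕ} (u v : Amb α β) : addInner u v = addInner v u := by
  simp only [addInner, mul_comm]

/-- The inner product with a fixed vector, as an additive homomorphism. -/
def addInnerHom {α β : ℕ} (u : Amb α β) : Amb α β →+ Z4 where
  toFun := addInner u
  map_zero' := by rw [addInner_comm, addInner_zero_left]
  map_add' v w := by
    rw [addInner_comm, addInner_add_left, addInner_comm v, addInner_comm w]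

/-- Additive homomorphisms out of `ZMod n` agree when they agree at `1`. -/
lemma ZMod.addMonoidHom_ext_one {n : ℕ} {A : Type*} [AddGroup A] {f g : ZMod n →+ A}
    (h : f 1 = g 1) : f = g := by
  ext x
  obtain ⟨k, rfl⟩ := ZMod.intCast_surjective x
  rw [← zsmul_one, map_zsmul, map_zsmul, h]

/-- The inner product is perfect: every homomorphism to `Z₄` is the inner product with
some vector. -/
lemma exists_addInnerHom_eq {α β : ℕ} (φ : Amb α β →+ Z4) : ∃ w, addInnerHom w = φ := by
  have two_torsion : ∀ i, φ (Pi.single i 1, 0) + φ (Pi.single i 1, 0) = 0 := fun i => by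
    have h : (1 : Z2) + 1 = 0 := by decide
    rw [← map_add, Prod.mk_add_mk, ← Pi.single_add, h, Pi.single_zero, add_zero]
    exact map_zero φ
  have lift_eq : ∀ z : Z4, z + z = 0 → 2 * (((if z = 0 then 0 else 1 : Z2).val : ℕ) : Z4) = z := by
    decide
  refine ⟨(fun i => if φ (Pi.single i 1, 0) = 0 then 0 else 1,
    fun j => φ (0, Pi.single j 1)), ?_⟩
  rw [← AddMonoidHom.coprod_unique (addInnerHom _), ← AddMonoidHom.coprod_unique φ]
  congr 1
  · refine AddMonoidHom.functions_ext' _ _ _ fun i => ZMod.addMonoidHom_ext_one ?_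
    have val_single : ∀ k : Fin α, ((Pi.single i (1 : Z2) : Fin α → Z2) k).val =
        if k = i then 1 else 0 := fun k => by
      by_cases h : k = i
      · subst h; simp [ZMod.val_one]
      · simp [h]
    simpa [addInnerHom, addInner, val_single, -ZMod.natCast_val] using lift_eq _ (two_torsion i)
  · refine AddMonoidHom.functions_ext' _ _ _ fun j => ZMod.addMonoidHom_ext_one ?_
    simp [addInnerHom, addInner, Pi.single_apply]

/-- `Z₄` is an injective module over itself. -/
lemma Z4_injective : Module.Injective Z4 Z4 := by
  refine Module.Baer.injective fun I g => ?_
  have := IsPrincipalIdealRing.of_surjective (Int.castRingHom Z4) ZMod.intCast_surjective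
  obtain ⟨a, rfl⟩ : ∃ a, I = Ideal.span {a} := (IsPrincipalIdealRing.principal I).principal
  have divides : ∀ a b : Z4, (∀ r, r * a = 0 → r * b = 0) → ∃ c, a * c = b := by decide
  have ha := Ideal.mem_span_singleton_self a
  obtain ⟨c, hc⟩ := divides a (g ⟨a, ha⟩) fun r hr => by
    have h : r • (⟨a, ha⟩ : Ideal.span {a}) = 0 := Subtype.ext hr
    rw [← smul_eq_mul, ← map_smul, h, map_zero]
  refine ⟨LinearMap.toSpanSingleton Z4 Z4 c, fun x hx => ?_⟩
  obtain ⟨r, rfl⟩ := Ideal.mem_span_singleton'.1 hx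
  have h : (⟨r * a, hx⟩ : Ideal.span {a}) = r • ⟨a, ha⟩ := rfl
  rw [h, map_smul, ← hc, LinearMap.toSpanSingleton_apply, smul_eq_mul, smul_eq_mul, mul_assoc]

/-- A linear map into an injective module factors through any linear map with smaller
kernel. -/
lemma Module.Injective.exists_comp_eq {R Q X Y : Type} [Ring R] [AddCommGroup Q] [Module R Q]
    [AddCommGroup X] [Module R X] [AddCommGroup Y] [Module R Y] (hQ : Module.Injective R Q)
    (i : X →ₗ[R] Y) (g : X →ₗ[R] Q) (h : i.ker ≤ g.ker) : ∃ f : Y →ₗ[R] Q, f ∘ₗ i = g := by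
  obtain ⟨f, hf⟩ := hQ.out (i.ker.liftQ i le_rfl)
    (LinearMap.ker_eq_bot.1 (Submodule.ker_liftQ_eq_bot _ _ _ le_rfl)) (i.ker.liftQ g h)
  exact ⟨f, LinearMap.ext fun x => hf (Submodule.Quotient.mk x)⟩

/-- For additive codes `C₁, C₂ ⊆ Z₂^α × Z₄^β`, the subgroup generated by
the union of their duals equals the dual of their intersection. -/
theorem stmt0 {α β : ℕ} (C₁ C₂ : AddSubgroup (Amb α β)) :
    dualCode C₁ ⊔ dualCode C₂ = dualCode (C₁ ⊓ C₂) := by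
  refine le_antisymm
    (sup_le (fun u hu v hv => hu v hv.1) fun u hu v hv => hu v hv.2) fun u hu => ?_
  have four_nsmul : ∀ x : Amb α β, 4 • x = 0 := fun x =>
    Prod.ext (funext fun i => (by decide : ∀ z : Z2, 4 • z = 0) _)
      (funext fun j => (by decide : ∀ z : Z4, 4 • z = 0) _)
  let _ : Module Z4 (Amb α β) := AddCommGroup.zmodModule four_nsmul
  let D₁ := AddSubgroup.toZModSubmodule 4 C₁
  let D₂ := AddSubgroup.toZModSubmodule 4 C₂
  obtain ⟨f, hf⟩ := Z4_injective.exists_comp_eq (D₂.mkQ ∘ₗ D₁.subtype)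
    ((addInnerHom u).toZModLinearMap 4 ∘ₗ D₁.subtype) fun x hx =>
      hu x ⟨x.2, (Submodule.Quotient.mk_eq_zero D₂).1 hx⟩
  obtain ⟨w, hw⟩ := exists_addInnerHom_eq (f ∘ₗ D₂.mkQ).toAddMonoidHom
  have hw' : ∀ v, addInner w v = f (D₂.mkQ v) := DFunLike.congr_fun hw
  refine AddSubgroup.mem_sup.2 ⟨u - w, fun v hv => ?_, w, fun v hv => ?_, sub_add_cancel u w⟩
  · have hv' : f (D₂.mkQ v) = addInner u v := LinearMap.congr_fun hf ⟨v, hv⟩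
    rw [sub_eq_add_neg, addInner_add_left, addInner_neg_left, hw', hv', add_neg_cancel]
  · have hv' : D₂.mkQ v = 0 := (Submodule.Quotient.mk_eq_zero D₂).2 hv
    rw [hw', hv', map_zero]
end

section
/- For any two quaternary linear codes C₁ and C₂ of type (0,β;γ₁,δ₁) and (0,β;γ₂,δ₂) respectively (additive subgroups of Z₄^β), the code ⟨C₁,C₂⟩ is a quaternary linear code of type (0,β;γ,δ) for some natural numbers γ, δ satisfying max(δ₁,δ₂) ≤ δ ≤ min(δ₁+δ₂, β) and max(δ, max(γ₁+δ₁, γ₂+δ₂)) ≤ γ+δ ≤ min(γ₁+γ₂+δ₁+δ₂, β). -/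
open scoped BigOperators

namespace AddSubgroup

variable {G H : Type*} [AddCommGroup G] [AddCommGroup H]

lemma relIndex_mul_card_inf (K L : AddSubgroup G) :
    Nat.card ↥(K ⊓ L) * K.relIndex L = Nat.card L := by
  have h := relIndex_mul_relIndex ⊥ (K ⊓ L) L bot_le inf_le_right
  rwa [relIndex_bot_left, relIndex_bot_left, inf_relIndex_right] at h

lemma card_ker_inf_mul_card_map (f : G →+ H) (K : AddSubgroup G) :
    Nat.card ↥(f.ker ⊓ K) * Nat.card (K.map f) = Nat.card K := by
  rw [← relIndex_ker, relIndex_mul_card_inf]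

lemma card_sup_mul_card_inf (K L : AddSubgroup G) :
    Nat.card ↥(K ⊔ L) * Nat.card ↥(K ⊓ L) = Nat.card K * Nat.card L := by
  rw [← relIndex_mul_card_inf L (K ⊔ L), inf_of_le_left le_sup_right, relIndex_sup_right,
    ← relIndex_mul_card_inf L K, inf_comm K L]
  ring

lemma card_sup_le [Finite G] (K L : AddSubgroup G) :
    Nat.card ↥(K ⊔ L) ≤ Nat.card K * Nat.card L :=
  card_sup_mul_card_inf K L ▸ Nat.le_mul_of_pos_right _ Nat.card_pos

/-- For an endomorphism `f`, the cardinality of `ker f ∩ K` is submultiplicative in `K`. -/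
lemma card_ker_inf_sup_le [Finite G] (f : G →+ G) (K L : AddSubgroup G)
    (hKL : (K.map f) ⊓ (L.map f) ≤ K ⊓ L) :
    Nat.card ↥(f.ker ⊓ (K ⊔ L)) ≤ Nat.card ↥(f.ker ⊓ K) * Nat.card ↥(f.ker ⊓ L) := by
  have hsup := card_sup_mul_card_inf K L
  have hmap := card_sup_mul_card_inf (K.map f) (L.map f)
  have hle : Nat.card ↥(K.map f ⊓ L.map f) ≤ Nat.card ↥(K ⊓ L) := card_le_of_le hKL
  rw [← map_sup] at hmap
  rw [← card_ker_inf_mul_card_map f (K ⊔ L), ← card_ker_inf_mul_card_map f K,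
    ← card_ker_inf_mul_card_map f L] at hsup
  refine Nat.le_of_mul_le_mul_right (c := Nat.card ↥(K ⊓ L) * Nat.card ((K ⊔ L).map f)) ?_
    (Nat.mul_pos Nat.card_pos Nat.card_pos)
  calc _ = Nat.card ↥(f.ker ⊓ K) * Nat.card ↥(f.ker ⊓ L) *
        (Nat.card (K.map f) * Nat.card (L.map f)) := by linarith
    _ = Nat.card ↥(f.ker ⊓ K) * Nat.card ↥(f.ker ⊓ L) *
        (Nat.card ↥(K.map f ⊓ L.map f) * Nat.card ((K ⊔ L).map f)) := by rw [← hmap]; ring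
    _ ≤ _ := by gcongr

end AddSubgroup

/-- Doubling on the ambient group. -/
abbrev doubling (α β : ℕ) : Amb α β →+ Amb α β := nsmulAddMonoidHom 2

lemma map_doubling_le {α β : ℕ} (C : AddSubgroup (Amb α β)) : C.map (doubling α β) ≤ C := by
  rintro _ ⟨x, hx, rfl⟩
  exact C.nsmul_mem hx 2

lemma doubling_doubling {β : ℕ} (x : Amb 0 β) : doubling 0 β (doubling 0 β x) = 0 := by
  have h : ∀ z : Z4, 2 • 2 • z = 0 := by decide
  ext i
  · exact i.elim0
  · exact h _

lemma map_doubling_le_ker {β : ℕ} (C : AddSubgroup (Amb 0 β)) :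
    C.map (doubling 0 β) ≤ (doubling 0 β).ker := by
  rintro _ ⟨x, -, rfl⟩
  exact doubling_doubling x

lemma card_ker_doubling_le (β : ℕ) : Nat.card (doubling 0 β).ker ≤ 2 ^ β := by
  have hcard : Nat.card (Fin β → {z : Z4 // 2 • z = 0}) = 2 ^ β := by
    rw [Nat.card_fun, Nat.card_fin, Nat.card_eq_fintype_card]
    rfl
  rw [← hcard]
  refine Nat.card_le_card_of_injective
    (fun x j => ⟨x.1.2 j, congrFun (congrArg Prod.snd x.2) j⟩) fun x y h => ?_
  ext i
  · exact i.elim0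
  · exact congrArg Subtype.val (congrFun h i)

lemma card_eq_two_pow {β : ℕ} (C : AddSubgroup (Amb 0 β)) : ∃ n, Nat.card C = 2 ^ n := by
  have hcard : Nat.card (Amb 0 β) = 2 ^ (2 * β) := by
    simp [pow_mul]
  obtain ⟨n, -, hn⟩ := (Nat.dvd_prime_pow Nat.prime_two).1 (hcard ▸ C.card_addSubgroup_dvd_card)
  exact ⟨n, hn⟩

lemma isOfType_iff_card_map_doubling {α β γ δ : ℕ} (C : AddSubgroup (Amb α β)) :
    isOfType C γ δ ↔ Nat.card (C.map (doubling α β)) = 2 ^ δ ∧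
      Nat.card ↥((doubling α β).ker ⊓ C) = 2 ^ (γ + δ) := by
  have htor : Nat.card {x : Amb α β // x ∈ C ∧ x + x = 0} =
      Nat.card ↥((doubling α β).ker ⊓ C) :=
    Nat.card_congr (Equiv.subtypeEquivRight fun x => by
      rw [AddSubgroup.mem_inf, AddMonoidHom.mem_ker, nsmulAddMonoidHom_apply, two_nsmul, and_comm])
  rw [isOfType, htor, ← AddSubgroup.card_ker_inf_mul_card_map (doubling α β) C]
  refine and_congr_left fun h => ?_
  rw [h, two_mul, ← add_assoc, pow_add 2 (γ + δ), Nat.mul_right_inj (by positivity)]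

/-- bounds on the type of the span of two quaternary linear codes. -/
theorem stmt1 {β γ₁ δ₁ γ₂ δ₂ : ℕ} (C₁ C₂ : AddSubgroup (Amb 0 β))
    (h₁ : isOfType C₁ γ₁ δ₁) (h₂ : isOfType C₂ γ₂ δ₂) :
    ∃ γ δ : ℕ, isOfType (C₁ ⊔ C₂) γ δ ∧
      max δ₁ δ₂ ≤ δ ∧ δ ≤ min (δ₁ + δ₂) β ∧
      max δ (max (γ₁ + δ₁) (γ₂ + δ₂)) ≤ γ + δ ∧
      γ + δ ≤ min (γ₁ + γ₂ + δ₁ + δ₂) β := by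
  rw [isOfType_iff_card_map_doubling] at h₁ h₂
  obtain ⟨hd₁, ht₁⟩ := h₁
  obtain ⟨hd₂, ht₂⟩ := h₂
  obtain ⟨d, hd⟩ := card_eq_two_pow ((C₁ ⊔ C₂).map (doubling 0 β))
  obtain ⟨t, ht⟩ := card_eq_two_pow ((doubling 0 β).ker ⊓ (C₁ ⊔ C₂))
  have exp_le {m n : ℕ} (h : 2 ^ m ≤ 2 ^ n) : m ≤ n := (Nat.pow_le_pow_iff_right one_lt_two).1 h
  have hdt : d ≤ t := exp_le <| hd ▸ ht ▸
    AddSubgroup.card_le_of_le (le_inf (map_doubling_le_ker _) (map_doubling_le _))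
  have htβ : t ≤ β := exp_le <| ht ▸
    (AddSubgroup.card_le_of_le inf_le_left).trans (card_ker_doubling_le β)
  have hdle₁ : δ₁ ≤ d := exp_le <| hd ▸ hd₁ ▸
    AddSubgroup.card_le_of_le (AddSubgroup.map_mono le_sup_left)
  have hdle₂ : δ₂ ≤ d := exp_le <| hd ▸ hd₂ ▸
    AddSubgroup.card_le_of_le (AddSubgroup.map_mono le_sup_right)
  have htle₁ : γ₁ + δ₁ ≤ t := exp_le <| ht ▸ ht₁ ▸
    AddSubgroup.card_le_of_le (inf_le_inf_left _ le_sup_left)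
  have htle₂ : γ₂ + δ₂ ≤ t := exp_le <| ht ▸ ht₂ ▸
    AddSubgroup.card_le_of_le (inf_le_inf_left _ le_sup_right)
  have hdadd : d ≤ δ₁ + δ₂ := exp_le <| by
    rw [pow_add, ← hd, ← hd₁, ← hd₂, AddSubgroup.map_sup]
    exact AddSubgroup.card_sup_le _ _
  have htadd : t ≤ (γ₁ + δ₁) + (γ₂ + δ₂) := exp_le <| by
    rw [pow_add, ← ht, ← ht₁, ← ht₂]
    exact AddSubgroup.card_ker_inf_sup_le _ _ _
      (inf_le_inf (map_doubling_le C₁) (map_doubling_le C₂))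
  refine ⟨t - d, d, (isOfType_iff_card_map_doubling _).2 ⟨hd, ?_⟩, ?_, ?_, ?_, ?_⟩
  · rw [ht, Nat.sub_add_cancel hdt]
  all_goals omega
end

section
/- For any t ≥ 3 and any integer l with t+1 ≤ l ≤ 2t, there exist two quaternary linear perfect codes C₁ and C₂ of length β = 2^(t−1) such that η(C₁,C₂) = 2^(2β−l). -/
open scoped BigOperators

/-- The Lee weight of an element of `Z₄`. -/
def leeWt (x : Z4) : ℕ := if x = 0 then 0 else if x = 2 then 2 else 1

lemma leeWt_cast (x : Z4) : ((leeWt x : ℕ) : Z2) = ZMod.castHom (by decide : 2 ∣ 4) Z2 x := by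
  revert x; decide

lemma hammingDist_grayMap {β : ℕ} (u v : Amb 0 β) :
    hammingDist (grayMap u) (grayMap v) = ∑ j, leeWt (u.2 j - v.2 j) := by
  have key : ∀ x y : Z4,
      (if (grayPhi x).1 ≠ (grayPhi y).1 then 1 else 0) +
        (if (grayPhi x).2 ≠ (grayPhi y).2 then 1 else 0) = leeWt (x - y) := by decide
  rw [hammingDist, Finset.card_filter, Fintype.sum_sum_type, Fintype.sum_prod_type]
  simp only [Finset.univ_eq_empty, Finset.sum_empty, zero_add, Fin.sum_univ_two]
  exact Finset.sum_congr rfl fun j _ => key (u.2 j) (v.2 j)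

lemma grayMap_injective {β : ℕ} : Function.Injective (grayMap (α := 0) (β := β)) := by
  intro u v h
  have hd : hammingDist (grayMap u) (grayMap v) = 0 := by rw [h, hammingDist_self]
  rw [hammingDist_grayMap, Finset.sum_eq_zero_iff] at hd
  have key : ∀ x y : Z4, leeWt (x - y) = 0 → x = y := by decide
  exact Prod.ext (Subsingleton.elim _ _) (funext fun j => key _ _ (hd j (Finset.mem_univ j)))

/-- The quaternary code whose parity-check matrix has the columns `h j`. -/
def checkCode {β : ℕ} {G : Type} [AddCommGroup G] [Module Z4 G] (h : Fin β → G) :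
    AddSubgroup (Amb 0 β) :=
  (LinearMap.ker (Fintype.linearCombination Z4 h)).toAddSubgroup.comap
    (AddMonoidHom.snd (Fin 0 → Z2) (Fin β → Z4))

lemma mem_checkCode {β : ℕ} {G : Type} [AddCommGroup G] [Module Z4 G] {h : Fin β → G}
    {u : Amb 0 β} : u ∈ checkCode h ↔ ∑ j, u.2 j • h j = 0 := by
  simp [checkCode, Fintype.linearCombination_apply]

lemma card_checkCode {β n : ℕ} {G : Type} [AddCommGroup G] [Module Z4 G] {h : Fin β → G}
    (hspan : Submodule.span Z4 (Set.range h) = ⊤) (hG : Nat.card G = 2 ^ n) :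
    Nat.card (checkCode h) = 2 ^ (2 * β - n) := by
  set L := Fintype.linearCombination Z4 h
  have hker : Nat.card (checkCode h) = Nat.card (LinearMap.ker L) := by
    refine Nat.card_congr
      { toFun := fun u => ⟨u.1.2, u.2⟩
        invFun := fun y => ⟨(0, y.1), y.2⟩
        left_inv := fun u => Subtype.ext (Prod.ext (Subsingleton.elim _ _) rfl)
        right_inv := fun y => rfl }
  have hsurj : LinearMap.range L = ⊤ := by rw [Fintype.range_linearCombination, hspan]
  have hquot : Nat.card ((Fin β → Z4) ⧸ LinearMap.ker L) = 2 ^ n := by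
    rw [← hG]
    exact Nat.card_congr
      (L.quotKerEquivOfSurjective (LinearMap.range_eq_top.mp hsurj)).toEquiv
  have hcard := (LinearMap.ker L).card_eq_card_quotient_mul_card
  have htot : Nat.card (Fin β → Z4) = 2 ^ (2 * β) := by
    rw [Nat.card_fun]; simp [pow_mul]
  rw [htot, hquot] at hcard
  have hn : n ≤ 2 * β :=
    (Nat.pow_dvd_pow_iff_le_right (by norm_num : 1 < 2)).mp ⟨_, by rw [hcard, mul_comm]⟩
  rw [hker]
  refine Nat.eq_of_mul_eq_mul_left (pow_pos two_pos n) ?_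
  rw [← pow_add, Nat.add_sub_cancel' hn, hcard, mul_comm]

lemma span_range_one_pair {β : ℕ} {A : Type} [AddCommGroup A] [Module Z4 A] (a : Fin β ≃ A) :
    Submodule.span Z4 (Set.range fun j => ((1 : Z4), a j)) = ⊤ := by
  rw [eq_top_iff]
  rintro ⟨c, x⟩ -
  have hmem : ∀ y, ((1 : Z4), y) ∈ Submodule.span Z4 (Set.range fun j => ((1 : Z4), a j)) :=
    fun y => Submodule.subset_span ⟨a.symm y, by simp⟩
  have := Submodule.add_mem _ (hmem x) (Submodule.smul_mem _ (c - 1) (hmem 0))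
  simpa using this

lemma four_le_sum_leeWt {β : ℕ} {A : Type} [AddCommGroup A] [Module Z4 A] {a : Fin β → A}
    (ha : Function.Injective a) {d : Fin β → Z4} (hd : d ≠ 0) (hsum : ∑ j, d j = 0)
    (hsuma : ∑ j, d j • a j = 0) : 4 ≤ ∑ j, leeWt (d j) := by
  have hpos : ∀ x : Z4, x ≠ 0 → 1 ≤ leeWt x := by decide
  have heven : (∑ j, leeWt (d j)) % 2 = 0 := by
    have : ((∑ j, leeWt (d j) : ℕ) : Z2) = 0 := by
      rw [Nat.cast_sum, Finset.sum_congr rfl fun j _ => leeWt_cast (d j), ← map_sum, hsum, map_zero]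
    exact Nat.mod_eq_zero_of_dvd ((ZMod.natCast_eq_zero_iff _ 2).mp this)
  obtain ⟨i, hi⟩ : ∃ i, d i ≠ 0 := by
    by_contra! h; exact hd (funext h)
  obtain ⟨k, hki, hk⟩ : ∃ k, k ≠ i ∧ d k ≠ 0 := by
    by_contra! h
    rw [Fintype.sum_eq_single i h] at hsum
    exact hi hsum
  by_cases h3 : ∃ m, (m ≠ i ∧ m ≠ k) ∧ d m ≠ 0
  · obtain ⟨m, ⟨hmi, hmk⟩, hm⟩ := h3
    have hle : ∑ j ∈ {i, k, m}, leeWt (d j) ≤ ∑ j, leeWt (d j) :=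
      Finset.sum_le_sum_of_subset (Finset.subset_univ _)
    rw [Finset.sum_insert (by simp [hki.symm, hmi.symm]), Finset.sum_pair hmk.symm] at hle
    have := hpos _ hi
    have := hpos _ hk
    have := hpos _ hm
    omega
  · push Not at h3
    rw [Fintype.sum_eq_add i k hki.symm h3] at hsum
    rw [Fintype.sum_eq_add i k hki.symm fun m hm => by rw [h3 m hm, zero_smul],
      eq_neg_of_add_eq_zero_right hsum, neg_smul, ← sub_eq_add_neg, ← smul_sub] at hsuma
    rw [Fintype.sum_eq_add i k hki.symm fun m hm => by rw [h3 m hm]; rfl,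
      eq_neg_of_add_eq_zero_right hsum]
    have hcase : ∀ x : Z4, x ≠ 0 → x * x = 1 ∨ 4 ≤ leeWt x + leeWt (-x) := by decide
    refine (hcase _ hi).resolve_left fun h1 => hki (ha ?_).symm
    have := congrArg (d i • ·) hsuma
    simpa [smul_smul, h1, sub_eq_zero] using this

lemma isQuatPerfect_checkCode {t : ℕ} (ht : 3 ≤ t) {A : Type} [AddCommGroup A] [Module Z4 A]
    (a : Fin (2 ^ (t - 1)) ≃ A) :
    isQuatPerfect t (2 ^ (t - 1)) (checkCode fun j => ((1 : Z4), a j)) := by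
  have hA : Nat.card A = 2 ^ (t - 1) := by rw [← Nat.card_congr a, Nat.card_fin]
  have hG : Nat.card (Z4 × A) = 2 ^ (t + 1) := by
    rw [Nat.card_prod, hA, Nat.card_zmod, show t + 1 = 2 + (t - 1) by omega, pow_add]
    rfl
  have hmem : ∀ u : Amb 0 (2 ^ (t - 1)), u ∈ (checkCode fun j => ((1 : Z4), a j)) ↔
      ∑ j, u.2 j = 0 ∧ ∑ j, u.2 j • a j = 0 := by
    intro u
    simp [mem_checkCode, Prod.ext_iff, Prod.fst_sum, Prod.snd_sum]
  refine ⟨ht, rfl, ?_, ?_, ?_⟩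
  · rw [Nat.card_image_of_injective grayMap_injective, Nat.sub_sub]
    exact card_checkCode (span_range_one_pair a) hG
  · rintro _ ⟨u, hu, rfl⟩ _ ⟨v, hv, rfl⟩ huv
    rw [hammingDist_grayMap]
    have huv' : (u - v) ∈ (checkCode fun j => ((1 : Z4), a j)) := sub_mem hu hv
    rw [hmem] at huv'
    refine four_le_sum_leeWt a.injective (d := (u - v).2) (fun h0 => huv ?_) huv'.1 huv'.2
    exact congrArg grayMap (sub_eq_zero.mp (Prod.ext (Subsingleton.elim _ _) h0))
  · have : Finite A := Finite.of_equiv _ a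
    have : Fact (Nat.Prime 2) := ⟨Nat.prime_two⟩
    obtain ⟨x, hx⟩ := exists_prime_addOrderOf_dvd_card' (G := A) 2
      (hA ▸ dvd_pow_self 2 (by omega))
    have h2x : (2 : Z4) • x = 0 := by
      rw [two_smul, ← two_nsmul, ← hx, addOrderOf_nsmul_eq_zero]
    have hx0 : x ≠ 0 := by rintro rfl; simp at hx
    have hne : a.symm x ≠ a.symm 0 := by simpa using hx0
    have hdist : hammingDist (grayMap ((0, Pi.single (a.symm x) 2 + Pi.single (a.symm 0) 2) :
        Amb 0 (2 ^ (t - 1)))) (grayMap 0) = 4 := by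
      rw [hammingDist_grayMap,
        Fintype.sum_eq_add _ _ hne fun m hm => by simp [hm.1, hm.2, leeWt]]
      simp only [Pi.add_apply, Pi.single_eq_same, Pi.single_eq_of_ne hne,
        Pi.single_eq_of_ne hne.symm]
      rfl
    refine ⟨_, ⟨(0, Pi.single (a.symm x) 2 + Pi.single (a.symm 0) 2), ?_, rfl⟩,
      _, ⟨0, zero_mem _, rfl⟩, fun h => ?_, hdist⟩
    · rw [SetLike.mem_coe, hmem]
      constructor
      · simp only [Pi.add_apply, Finset.sum_add_distrib, Finset.sum_pi_single', Finset.mem_univ,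
          if_true]
        decide
      · simp [add_smul, Finset.sum_add_distrib, Pi.single_apply, ite_smul, h2x]
    · rw [h, hammingDist_self] at hdist
      omega

lemma card_checkCode_inf {β n : ℕ} {A B W : Type} [AddCommGroup A] [Module Z4 A] [AddCommGroup B]
    [Module Z4 B] [AddCommGroup W] [Module Z4 W] {a : Fin β → A} {b : Fin β → B} {w : Fin β → W}
    (hw : ∀ y : Fin β → Z4, ∑ j, y j = 0 → ∑ j, y j • a j = 0 →
      (∑ j, y j • b j = 0 ↔ ∑ j, y j • w j = 0))
    (hspan : Submodule.span Z4 (Set.range fun j => ((1 : Z4), a j, w j)) = ⊤)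
    (hcard : Nat.card (Z4 × A × W) = 2 ^ n) :
    Nat.card ↥((checkCode fun j => ((1 : Z4), a j)) ⊓ checkCode fun j => ((1 : Z4), b j)) =
      2 ^ (2 * β - n) := by
  rw [← card_checkCode hspan hcard]
  congr 2
  ext u
  have := hw u.2
  simp only [AddSubgroup.mem_inf, mem_checkCode, Prod.ext_iff, Prod.fst_sum, Prod.snd_sum,
    Prod.smul_mk, smul_eq_mul, mul_one, Prod.fst_zero, Prod.snd_zero]
  tauto

instance : Module Z4 Z2 := Module.compHom Z2 (ZMod.castHom (by decide : 2 ∣ 4) Z2)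

lemma eq_top_of_single_mem {n : ℕ} {S : Submodule Z4 (Fin n → Z2)}
    (hS : ∀ i, Pi.single i 1 ∈ S) : S = ⊤ := by
  rw [eq_top_iff]
  intro x _
  rw [← Finset.univ_sum_single x]
  refine Submodule.sum_mem _ fun i _ => ?_
  have h01 : ∀ c : Z2, c = 0 ∨ c = 1 := by decide
  rcases h01 (x i) with h | h
  · rw [h, Pi.single_zero]; exact zero_mem _
  · rw [h]; exact hS i

/-- The all-ones vector followed by its translates by the first `k` unit vectors. -/
def shiftedOnes {m k : ℕ} (hk : k ≤ m) : Fin (k + 1) → Fin m → Z2 :=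
  Fin.cons 1 fun i => 1 + Pi.single (Fin.castLE hk i) 1

lemma shiftedOnes_injective {m k : ℕ} (hk : k ≤ m) : Function.Injective (shiftedOnes hk) := by
  rw [shiftedOnes, Fin.cons_injective_iff]
  constructor
  · rintro ⟨i, hi⟩
    simpa using congrFun hi (Fin.castLE hk i)
  · intro i j hij
    have := congrFun (add_left_cancel hij) (Fin.castLE hk i)
    by_contra hne
    rw [Pi.single_eq_same, Pi.single_eq_of_ne] at this
    · exact one_ne_zero this
    · simpa using hne

/-- The cyclic permutation of the entries of `shiftedOnes`, fixing all other vectors. -/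
noncomputable def shiftedCycle {m k : ℕ} (hk : k ≤ m) : Equiv.Perm (Fin m → Z2) :=
  (finRotate (k + 1)).viaEmbedding ⟨shiftedOnes hk, shiftedOnes_injective hk⟩

lemma shiftedCycle_shiftedOnes {m k : ℕ} (hk : k ≤ m) (r : Fin (k + 1)) :
    shiftedCycle hk (shiftedOnes hk r) = shiftedOnes hk (finRotate (k + 1) r) :=
  Equiv.Perm.viaEmbedding_apply _ ⟨shiftedOnes hk, shiftedOnes_injective hk⟩ r

lemma shiftedCycle_of_notMem {m k : ℕ} (hk : k ≤ m) {x : Fin m → Z2}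
    (hx : x ∉ Set.range (shiftedOnes hk)) : shiftedCycle hk x = x :=
  Equiv.Perm.viaEmbedding_apply_of_notMem _ ⟨shiftedOnes hk, shiftedOnes_injective hk⟩ x hx

lemma shiftedOnes_apply {m k : ℕ} (hk : k ≤ m) (r : Fin (k + 1)) {c : Fin m}
    (hc : ∀ i : Fin k, r = i.succ → Fin.castLE hk i ≠ c) : shiftedOnes hk r c = 1 := by
  cases r using Fin.cases with
  | zero => rfl
  | succ i => simp [shiftedOnes, Pi.single_eq_of_ne (hc i rfl).symm]

lemma shiftedCycle_apply_of_le {m k : ℕ} (hk : k ≤ m) (x : Fin m → Z2) {c : Fin m}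
    (hc : k ≤ c) : shiftedCycle hk x c = x c := by
  have hne : ∀ i : Fin k, Fin.castLE hk i ≠ c := by
    rintro i rfl
    have := i.isLt
    simp only [Fin.val_castLE] at hc
    omega
  by_cases hx : x ∈ Set.range (shiftedOnes hk)
  · obtain ⟨r, rfl⟩ := hx
    rw [shiftedCycle_shiftedOnes, shiftedOnes_apply hk _ fun i _ => hne i,
      shiftedOnes_apply hk _ fun i _ => hne i]
  · rw [shiftedCycle_of_notMem hk hx]

lemma exists_shiftedOnes_eq_one {m k : ℕ} (hm : 3 ≤ m) (hk : k ≤ m) (r : Fin (k + 1))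
    (i : Fin m) : ∃ c, c ≠ i ∧ shiftedOnes hk r c = 1 := by
  cases r using Fin.cases with
  | zero =>
    obtain ⟨c, hc, -⟩ := Fin.exists_ne_and_ne_of_two_lt i i hm
    exact ⟨c, hc, rfl⟩
  | succ s =>
    obtain ⟨c, hc, hcs⟩ := Fin.exists_ne_and_ne_of_two_lt i (Fin.castLE hk s) hm
    refine ⟨c, hc, shiftedOnes_apply hk _ fun j hj => ?_⟩
    rw [← Fin.succ_injective _ hj]
    exact hcs.symm

lemma shiftedCycle_single {m k : ℕ} (hm : 3 ≤ m) (hk : k ≤ m) (i : Fin m) (z : Z2) :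
    shiftedCycle hk (Pi.single i z) = Pi.single i z := by
  refine shiftedCycle_of_notMem hk ?_
  rintro ⟨r, hr⟩
  obtain ⟨c, hc, h1⟩ := exists_shiftedOnes_eq_one hm hk r i
  rw [hr, Pi.single_eq_of_ne hc] at h1
  exact zero_ne_one h1

/-- The first `k` coordinates of the displacement of a vector under `shiftedCycle`. -/
noncomputable def displacement {m k : ℕ} (hk : k ≤ m) (x : Fin m → Z2) : Fin k → Z2 :=
  fun i => shiftedCycle hk x (Fin.castLE hk i) - x (Fin.castLE hk i)

lemma displacement_single {m k : ℕ} (hm : 3 ≤ m) (hk : k ≤ m) (i : Fin m) (z : Z2) :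
    displacement hk (Pi.single i z) = 0 := by
  funext c
  simp [displacement, shiftedCycle_single hm]

lemma eq_top_of_displacement_mem {m k : ℕ} (hk : k ≤ m) {S : Submodule Z4 (Fin k → Z2)}
    (hS : ∀ x, displacement hk x ∈ S) : S = ⊤ := by
  have key : ∀ (n : ℕ) (hn : n < k + 1),
      (fun i => shiftedOnes hk ⟨n, hn⟩ (Fin.castLE hk i) - 1) ∈ S := by
    intro n
    induction n with
    | zero =>
      intro hn
      convert zero_mem S using 1
      funext i
      exact sub_self _
    | succ n ih =>
      intro hn
      convert add_mem (hS (shiftedOnes hk ⟨n, by omega⟩)) (ih (by omega)) using 1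
      funext i
      simp only [displacement, shiftedCycle_shiftedOnes, Pi.add_apply]
      rw [finRotate_of_lt (by omega)]
      ring
  refine eq_top_of_single_mem fun i => ?_
  convert key (i + 1) (by omega) using 1
  funext c
  change _ = shiftedOnes hk i.succ (Fin.castLE hk c) - 1
  simp [shiftedOnes, Pi.single_apply]

lemma span_range_displacement {m k β : ℕ} (hm : 3 ≤ m) (hk : k ≤ m)
    (e : Fin β ≃ (Fin m → Z2)) :
    Submodule.span Z4 (Set.range fun j => ((1 : Z4), e j, displacement hk (e j))) = ⊤ := by
  set S := Submodule.span Z4 (Set.range fun j => ((1 : Z4), e j, displacement hk (e j)))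
  have hmem : ∀ x, ((1 : Z4), x, displacement hk x) ∈ S := fun x =>
    Submodule.subset_span ⟨e.symm x, by simp⟩
  have hd0 : displacement hk (0 : Fin m → Z2) = 0 := by
    simpa using displacement_single hm hk ⟨0, by omega⟩ 0
  have h1 : ((1 : Z4), (0 : Fin m → Z2), (0 : Fin k → Z2)) ∈ S := by
    simpa [hd0] using hmem 0
  have hV : S.comap (LinearMap.inr Z4 Z4 ((Fin m → Z2) × (Fin k → Z2)) ∘ₗ
      LinearMap.inl Z4 (Fin m → Z2) (Fin k → Z2)) = ⊤ := by
    refine eq_top_of_single_mem fun i => ?_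
    simpa [displacement_single hm] using sub_mem (hmem (Pi.single i 1)) h1
  have hV' : ∀ x, ((0 : Z4), x, (0 : Fin k → Z2)) ∈ S := fun x =>
    (hV.ge (Submodule.mem_top (x := x)) :)
  have hW : S.comap (LinearMap.inr Z4 Z4 ((Fin m → Z2) × (Fin k → Z2)) ∘ₗ
      LinearMap.inr Z4 (Fin m → Z2) (Fin k → Z2)) = ⊤ := by
    refine eq_top_of_displacement_mem hk fun x => ?_
    simpa using sub_mem (sub_mem (hmem x) h1) (hV' x)
  have hW' : ∀ w, ((0 : Z4), (0 : Fin m → Z2), w) ∈ S := fun w =>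
    (hW.ge (Submodule.mem_top (x := w)) :)
  rw [eq_top_iff]
  rintro ⟨c, x, w⟩ -
  simpa using add_mem (add_mem (Submodule.smul_mem _ c h1) (hV' x)) (hW' w)

lemma exists_card_inf_of_four_le {t k : ℕ} (ht : 4 ≤ t) (hk : k ≤ t - 1) :
    ∃ C₁ C₂ : AddSubgroup (Amb 0 (2 ^ (t - 1))),
      isQuatPerfect t (2 ^ (t - 1)) C₁ ∧ isQuatPerfect t (2 ^ (t - 1)) C₂ ∧
      Nat.card ↥(C₁ ⊓ C₂) = 2 ^ (2 * 2 ^ (t - 1) - (t + 1 + k)) := by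
  let e : Fin (2 ^ (t - 1)) ≃ (Fin (t - 1) → Z2) := Fintype.equivOfCardEq (by simp)
  refine ⟨_, _, isQuatPerfect_checkCode (by omega) e,
    isQuatPerfect_checkCode (by omega) (e.trans (shiftedCycle hk)), ?_⟩
  refine card_checkCode_inf (w := fun j => displacement hk (e j)) ?_
    (span_range_displacement (by omega) hk e) ?_
  · intro y _ hy
    have hb : ∑ j, y j • (e.trans (shiftedCycle hk)) j =
        ∑ j, y j • (shiftedCycle hk (e j) - e j) := by
      simp only [smul_sub, Finset.sum_sub_distrib, hy, sub_zero, Equiv.trans_apply]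
    rw [hb]
    simp only [funext_iff, Finset.sum_apply, Pi.smul_apply, Pi.zero_apply, Pi.sub_apply,
      displacement]
    refine ⟨fun h i => h _, fun h c => ?_⟩
    rcases lt_or_ge (c : ℕ) k with hc | hc
    · exact h ⟨c, hc⟩
    · simp [shiftedCycle_apply_of_le hk _ hc]
  · rw [Nat.card_prod, Nat.card_prod, Nat.card_fun, Nat.card_fun]
    simp only [Nat.card_zmod, Nat.card_fin]
    rw [show t + 1 + k = 2 + ((t - 1) + k) by omega, pow_add, pow_add]
    rfl

lemma span_range_one_id {W : Type} [AddCommGroup W] [Module Z4 W] {w : Fin 4 → W} {g : W}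
    (h0 : w 0 = 0) (h1 : w 1 = 0) (h2 : w 2 = g) (hg : ∀ x, ∃ c : Z4, x = c • g) :
    Submodule.span Z4 (Set.range fun j : Fin 4 => ((1 : Z4), (Equiv.refl Z4) j, w j)) = ⊤ := by
  rw [eq_top_iff]
  rintro ⟨c, x, v⟩ -
  obtain ⟨s, rfl⟩ := hg v
  have hmem : ∀ j : Fin 4, ((1 : Z4), (Equiv.refl Z4) j, w j) ∈
      Submodule.span Z4 (Set.range fun j : Fin 4 => ((1 : Z4), (Equiv.refl Z4) j, w j)) :=
    fun j => Submodule.subset_span ⟨j, rfl⟩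
  have := add_mem (add_mem (Submodule.smul_mem _ (c - x + s) (hmem 0))
    (Submodule.smul_mem _ (x - 2 * s) (hmem 1))) (Submodule.smul_mem _ s (hmem 2))
  convert this using 1
  rw [h0, h1, h2]
  simp only [Prod.smul_mk, smul_zero, Prod.mk_add_mk, add_zero, zero_add]
  have e1 : c = (c - x + s) * 1 + (x - 2 * s) * 1 + s * 1 := by ring
  have e2 : x = (c - x + s) * 0 + (x - 2 * s) * 1 + s * 2 := by ring
  exact Prod.ext e1 (Prod.ext e2 rfl)

lemma exists_card_inf_five :
    ∃ C₁ C₂ : AddSubgroup (Amb 0 (2 ^ (3 - 1))),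
      isQuatPerfect 3 (2 ^ (3 - 1)) C₁ ∧ isQuatPerfect 3 (2 ^ (3 - 1)) C₂ ∧
      Nat.card ↥(C₁ ⊓ C₂) = 2 ^ (2 * 2 ^ (3 - 1) - 5) := by
  let b : Fin 4 → Z2 × Z2 := ![(0, 0), (0, 1), (1, 0), (1, 1)]
  have hb : Function.Bijective b := by decide
  refine ⟨_, _, isQuatPerfect_checkCode (A := Z4) le_rfl (Equiv.refl Z4),
    isQuatPerfect_checkCode le_rfl (Equiv.ofBijective b hb), ?_⟩
  refine card_checkCode_inf (A := Z4) (w := fun j => (b j).1) ?_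
    (span_range_one_id (g := 1) rfl rfl rfl (by decide)) ?_
  · intro y _ h
    have key : ∀ y₀ y₁ y₂ y₃ : Z4, y₀ * 0 + y₁ * 1 + y₂ * 2 + y₃ * 3 = 0 →
        (y₀ • b 0 + y₁ • b 1 + y₂ • b 2 + y₃ • b 3 = 0 ↔
          y₀ • (b 0).1 + y₁ • (b 1).1 + y₂ • (b 2).1 + y₃ • (b 3).1 = 0) := by decide
    have := key (y 0) (y 1) (y 2) (y 3) ((Fin.sum_univ_four _).symm.trans h)
    exact (Eq.congr_left (Fin.sum_univ_four fun j => y j • b j)).trans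
      (this.trans (Eq.congr_left (Fin.sum_univ_four fun j => y j • (b j).1)).symm)
  · simp

lemma exists_card_inf_six :
    ∃ C₁ C₂ : AddSubgroup (Amb 0 (2 ^ (3 - 1))),
      isQuatPerfect 3 (2 ^ (3 - 1)) C₁ ∧ isQuatPerfect 3 (2 ^ (3 - 1)) C₂ ∧
      Nat.card ↥(C₁ ⊓ C₂) = 2 ^ (2 * 2 ^ (3 - 1) - 6) := by
  let w : Fin 4 → Z4 := ![0, 0, 1, -1]
  refine ⟨_, _, isQuatPerfect_checkCode (A := Z4) le_rfl (Equiv.refl Z4),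
    isQuatPerfect_checkCode (A := Z4) le_rfl (Equiv.swap (2 : Z4) 3), ?_⟩
  refine card_checkCode_inf (A := Z4) (B := Z4) (w := w) ?_
    (span_range_one_id (g := 1) rfl rfl rfl (by decide)) ?_
  · intro y _ h
    have key : ∀ y₀ y₁ y₂ y₃ : Z4, y₀ * 0 + y₁ * 1 + y₂ * 2 + y₃ * 3 = 0 →
        (y₀ * 0 + y₁ * 1 + y₂ * 3 + y₃ * 2 = 0 ↔
          y₀ * w 0 + y₁ * w 1 + y₂ * w 2 + y₃ * w 3 = 0) := by decide
    have := key (y 0) (y 1) (y 2) (y 3) ((Fin.sum_univ_four _).symm.trans h)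
    exact (Eq.congr_left (Fin.sum_univ_four fun j => y j • (Equiv.swap (2 : Z4) 3) j)).trans
      (this.trans (Eq.congr_left (Fin.sum_univ_four fun j => y j • w j)).symm)
  · simp

/-- every intersection number `2^(2β-l)`, `t+1 ≤ l ≤ 2t`, is attained by
two quaternary linear perfect codes of length `β = 2^(t-1)`. -/
theorem stmt7 {t l : ℕ} (ht : 3 ≤ t) (hl₁ : t + 1 ≤ l) (hl₂ : l ≤ 2 * t) :
    ∃ C₁ C₂ : AddSubgroup (Amb 0 (2 ^ (t - 1))),
      isQuatPerfect t (2 ^ (t - 1)) C₁ ∧ isQuatPerfect t (2 ^ (t - 1)) C₂ ∧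
      Nat.card ↥(C₁ ⊓ C₂) = 2 ^ (2 * 2 ^ (t - 1) - l) := by
  rcases ht.eq_or_lt with rfl | ht4
  · obtain rfl | rfl | rfl : l = 4 ∨ l = 5 ∨ l = 6 := by omega
    · have hC := isQuatPerfect_checkCode le_rfl (Equiv.refl Z4 : Fin (2 ^ (3 - 1)) ≃ Z4)
      refine ⟨_, _, hC, hC, ?_⟩
      rw [inf_idem]
      exact (Nat.card_image_of_injective grayMap_injective _).symm.trans hC.2.2.1
    · exact exists_card_inf_five
    · exact exists_card_inf_six
  · obtain ⟨k, rfl⟩ := Nat.exists_eq_add_of_le hl₁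
    exact exists_card_inf_of_four_le ht4 (by omega)
end

section
/- Let β = 2^(t−1) with t ≥ 3 (so β ≥ 4), and let C₁ and C₂ be quaternary linear perfect codes of length β of dual type (0,β;γ₁,δ₁) and (0,β;γ₂,δ₂) respectively, such that C₁ ∩ C₂ is of dual type (0,β;i,j). Then for each i' ∈ {i+1, i+2} there exist two quaternary linear perfect codes of length 2β of dual type (0,2β;γ₁+1,δ₁) and (0,2β;γ₂+1,δ₂) respectively whose intersection is of dual type (0,2β;i',j). -/
open scoped BigOperators

/-- The Lee weight on `Z₄`. -/
def lee (a : Z4) : ℕ := min a.val (-a).val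

/-- The Lee weight of a quaternary word. -/
def leeWeight {n : ℕ} (x : Amb 0 n) : ℕ := ∑ i, lee (x.2 i)

lemma lee_add_le (a b : Z4) : lee (a + b) ≤ lee a + lee b := by
  revert a b; decide

lemma lee_unit_mul (s : Z4ˣ) (a : Z4) : lee (s * a) = lee a := by
  revert s a; decide

lemma unit_mul_unit_mul (s : Z4ˣ) (a : Z4) : (s : Z4) * (s * a) = a := by
  revert s a; decide

lemma two_mul_unit_mul (s : Z4ˣ) (a : Z4) : 2 * ((s : Z4) * a) = 2 * a := by
  revert s a; decide

lemma leeWeight_add_le {n : ℕ} (x y : Amb 0 n) :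
    leeWeight (x + y) ≤ leeWeight x + leeWeight y := by
  simp only [leeWeight, ← Finset.sum_add_distrib]
  exact Finset.sum_le_sum fun i _ => lee_add_le _ _

lemma leeWeight_neg {n : ℕ} (x : Amb 0 n) : leeWeight (-x) = leeWeight x := by
  have h : ∀ a : Z4, lee (-a) = lee a := by decide
  exact Finset.sum_congr rfl fun i _ => h _

lemma two_mul_leeWeight {n : ℕ} (x : Amb 0 n) : (2 : Z4) * (leeWeight x : Z4) = 2 * ∑ i, x.2 i := by
  have h : ∀ a : Z4, 2 * (lee a : Z4) = 2 * a := by decide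
  simp only [leeWeight, Nat.cast_sum, Finset.mul_sum, h]

lemma leeWeight_eq_zero_iff {n : ℕ} (x : Amb 0 n) : leeWeight x = 0 ↔ x = 0 := by
  have h : ∀ a : Z4, lee a = 0 ↔ a = 0 := by decide
  simp only [leeWeight, Finset.sum_eq_zero_iff, Finset.mem_univ, true_imp_iff, h]
  constructor
  · intro hx
    exact Prod.ext (Subsingleton.elim _ _) (funext hx)
  · rintro rfl i
    rfl

/-- The word with the single nonzero coordinate `a` at position `k`. -/
def unitWord {n : ℕ} (k : Fin n) (a : Z4) : Amb 0 n := (0, Pi.single k a)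

lemma sum_unitWord {n : ℕ} (k : Fin n) (a : Z4) : ∑ i, (unitWord k a).2 i = a := by
  simp [unitWord]

lemma leeWeight_unitWord {n : ℕ} (k : Fin n) (a : Z4) : leeWeight (unitWord k a) = lee a := by
  unfold leeWeight
  rw [Finset.sum_eq_single k]
  · simp [unitWord]
  · intro b _ hb
    simp [unitWord, hb, lee]
  · simp

lemma unitWord_add {n : ℕ} (k : Fin n) (a b : Z4) :
    unitWord k (a + b) = unitWord k a + unitWord k b := by
  simp [unitWord, Pi.single_add]

lemma sum_unitWord_eq {n : ℕ} (x : Amb 0 n) : ∑ k, unitWord k (x.2 k) = x := by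
  refine Prod.ext (Subsingleton.elim _ _) ?_
  rw [Prod.snd_sum]
  exact Finset.univ_sum_single x.2

lemma hammingDist_grayMap_s8 {n : ℕ} (x y : Amb 0 n) :
    hammingDist (grayMap x) (grayMap y) = leeWeight (x - y) := by
  have h : ∀ a b : Z4, (∑ c : Fin 2, if (if c = 0 then (grayPhi a).1 else (grayPhi a).2) ≠
      (if c = 0 then (grayPhi b).1 else (grayPhi b).2) then 1 else 0) = lee (a - b) := by
    decide
  rw [hammingDist, Finset.card_filter, Fintype.sum_sum_type, Fintype.sum_prod_type]
  simp only [Finset.univ_eq_empty, Finset.sum_empty, zero_add, leeWeight]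
  exact Finset.sum_congr rfl fun i _ => h (x.2 i) (y.2 i)

lemma grayMap_injective_s8 (n : ℕ) : Function.Injective (grayMap : Amb 0 n → _) := by
  intro x y h
  have := hammingDist_grayMap_s8 x y
  rw [h, hammingDist_self] at this
  exact sub_eq_zero.1 ((leeWeight_eq_zero_iff _).1 this.symm)

lemma minDistEq_grayMap_iff {n d : ℕ} (C : AddSubgroup (Amb 0 n)) :
    minDistEq (grayMap '' (C : Set (Amb 0 n))) d ↔
      (∀ x ∈ C, x ≠ 0 → d ≤ leeWeight x) ∧ ∃ x ∈ C, x ≠ 0 ∧ leeWeight x = d := by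
  unfold minDistEq
  simp only [Set.forall_mem_image, Set.exists_mem_image, hammingDist_grayMap_s8,
    (grayMap_injective_s8 n).ne_iff, SetLike.mem_coe]
  constructor
  · rintro ⟨h, x, hx, y, hy, hxy, hw⟩
    refine ⟨fun x hx hx0 => ?_, x - y, C.sub_mem hx hy, sub_ne_zero.2 hxy, hw⟩
    simpa using h hx C.zero_mem hx0
  · rintro ⟨h, x, hx, hx0, hw⟩
    exact ⟨fun x hx y hy hxy => h _ (C.sub_mem hx hy) (sub_ne_zero.2 hxy),
      x, hx, 0, C.zero_mem, hx0, by simpa using hw⟩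

lemma isQuatPerfect_iff {t n : ℕ} (C : AddSubgroup (Amb 0 n)) :
    isQuatPerfect t n C ↔ 3 ≤ t ∧ n = 2 ^ (t - 1) ∧ Nat.card C = 2 ^ (2 * n - t - 1) ∧
      (∀ x ∈ C, x ≠ 0 → 4 ≤ leeWeight x) ∧ ∃ x ∈ C, x ≠ 0 ∧ leeWeight x = 4 := by
  unfold isQuatPerfect
  rw [minDistEq_grayMap_iff, Nat.card_image_of_injective (grayMap_injective_s8 n)]
  rfl

lemma card_amb (n : ℕ) : Nat.card (Amb 0 n) = 2 ^ (2 * n) := by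
  rw [Nat.card_prod]
  simp [Nat.card_eq_fintype_card, pow_mul]

/-! ### Types of codes -/

lemma card_eq_two_mul_of_coset {A : Type*} [AddCommGroup A] {H K : AddSubgroup A} {g : A}
    (hHK : H ≤ K) (hg : g ∈ K) (hgH : g ∉ H) (hK : ∀ x ∈ K, x ∈ H ∨ x - g ∈ H) :
    Nat.card K = 2 * Nat.card H := by
  have hbij : Function.Bijective (fun p : Bool × H =>
      (⟨p.2 + if p.1 then g else 0,
        K.add_mem (hHK p.2.2) (by split_ifs <;> simp [hg])⟩ : K)) := by
    constructor
    · rintro ⟨b, x, hx⟩ ⟨c, y, hy⟩ h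
      simp only [Subtype.mk.injEq] at h
      rcases b <;> rcases c <;> simp at h ⊢
      · exact h
      · exact hgH ((H.add_mem_cancel_left hy).1 (h ▸ hx))
      · exact hgH ((H.add_mem_cancel_left hx).1 (h ▸ hy))
      · exact h
    · rintro ⟨x, hx⟩
      rcases hK x hx with h | h
      · exact ⟨(false, ⟨x, h⟩), by simp⟩
      · exact ⟨(true, ⟨x - g, h⟩), by simp⟩
  rw [← Nat.card_eq_of_bijective _ hbij, Nat.card_prod]
  simp

/-- The subgroup of elements `x` with `x + x = 0`. -/
def twoTorsion (A : Type*) [AddCommGroup A] : AddSubgroup A where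
  carrier := {x | x + x = 0}
  zero_mem' := add_zero 0
  add_mem' := by
    intro a b ha hb
    have : a + b + (a + b) = (a + a) + (b + b) := by abel
    simp only [Set.mem_ofPred_eq] at ha hb ⊢
    rw [this, ha, hb, add_zero]
  neg_mem' := by
    intro a ha
    simp only [Set.mem_ofPred_eq] at ha ⊢
    rw [← neg_add, ha, neg_zero]

lemma isOfType_iff {α β γ δ : ℕ} (C : AddSubgroup (Amb α β)) :
    isOfType C γ δ ↔ Nat.card C = 2 ^ (γ + 2 * δ) ∧
      Nat.card ↥(C ⊓ twoTorsion (Amb α β)) = 2 ^ (γ + δ) :=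
  Iff.rfl

lemma isOfType_succ_of_coset {α β γ δ : ℕ} {H K : AddSubgroup (Amb α β)} {g : Amb α β}
    (hHK : H ≤ K) (hg : g ∈ K) (hgH : g ∉ H) (hg2 : g + g = 0)
    (hK : ∀ x ∈ K, x ∈ H ∨ x - g ∈ H) (hH : isOfType H γ δ) : isOfType K (γ + 1) δ := by
  rw [isOfType_iff] at hH ⊢
  have hT : g ∈ twoTorsion (Amb α β) := hg2
  constructor
  · rw [card_eq_two_mul_of_coset hHK hg hgH hK, hH.1]
    ring
  · rw [card_eq_two_mul_of_coset (H := H ⊓ twoTorsion _) (g := g)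
      (inf_le_inf_right _ hHK) ⟨hg, hT⟩ (fun h => hgH h.1)
      (fun x hx => (hK x hx.1).imp (fun h => ⟨h, hx.2⟩)
        (fun h => ⟨h, (twoTorsion _).sub_mem hx.2 hT⟩)), hH.2]
    ring

lemma isOfType_map {α β α' β' γ δ : ℕ} {H : AddSubgroup (Amb α β)}
    (φ : Amb α β →+ Amb α' β') (hφ : Function.Injective φ) (hH : isOfType H γ δ) :
    isOfType (H.map φ) γ δ := by
  rw [isOfType_iff] at hH ⊢
  have h : H.map φ ⊓ twoTorsion _ = (H ⊓ twoTorsion _).map φ := by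
    ext y
    constructor
    · rintro ⟨⟨x, hx, rfl⟩, hy⟩
      refine ⟨x, ⟨hx, hφ ?_⟩, rfl⟩
      rw [map_add, map_zero]
      exact hy
    · rintro ⟨x, ⟨hx, hx2⟩, rfl⟩
      refine ⟨⟨x, hx, rfl⟩, ?_⟩
      change φ x + φ x = 0
      rw [← map_add, show x + x = 0 from hx2, map_zero]
  rw [h, ← hH.1, ← hH.2]
  exact ⟨Nat.card_congr (H.equivMapOfInjective φ hφ).symm.toEquiv,
    Nat.card_congr ((H ⊓ twoTorsion _).equivMapOfInjective φ hφ).symm.toEquiv⟩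

lemma addInner_eq_sum {n : ℕ} (u v : Amb 0 n) : addInner u v = ∑ i, u.2 i * v.2 i := by
  simp [addInner]

lemma addInner_add_right {n : ℕ} (u v w : Amb 0 n) :
    addInner u (v + w) = addInner u v + addInner u w := by
  simp [addInner_eq_sum, mul_add, Finset.sum_add_distrib]

lemma addInner_sub_left {n : ℕ} (u v w : Amb 0 n) :
    addInner (u - v) w = addInner u w - addInner v w := by
  rw [sub_eq_add_neg, addInner_add_left, addInner_neg_left, sub_eq_add_neg]

lemma addInner_unitWord_left {n : ℕ} (k : Fin n) (a : Z4) (x : Amb 0 n) :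
    addInner (unitWord k a) x = a * x.2 k := by
  rw [addInner_eq_sum, Finset.sum_eq_single k]
  · simp [unitWord]
  · intro b _ hb
    simp [unitWord, hb]
  · simp

/-- The words whose coordinate at `m` is even. -/
def evenAt {n : ℕ} (m : Fin n) : AddSubgroup (Amb 0 n) where
  carrier := {x | 2 * x.2 m = 0}
  zero_mem' := by simp
  add_mem' := by
    intro a b ha hb
    simp only [Set.mem_ofPred_eq, Prod.snd_add, Pi.add_apply, mul_add] at ha hb ⊢
    rw [ha, hb, add_zero]
  neg_mem' := by
    intro a ha
    simp only [Set.mem_ofPred_eq, Prod.snd_neg, Pi.neg_apply, mul_neg] at ha ⊢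
    rw [ha, neg_zero]

lemma mem_evenAt {n : ℕ} {m : Fin n} {x : Amb 0 n} : x ∈ evenAt m ↔ 2 * x.2 m = 0 := Iff.rfl

lemma isOfType_dualCode_inf_evenAt {n γ δ : ℕ} {C : AddSubgroup (Amb 0 n)} {m : Fin n}
    {c : Amb 0 n} (hc : c ∈ C) (hcm : c ∉ evenAt m) (hC : isOfType (dualCode C) γ δ) :
    isOfType (dualCode (C ⊓ evenAt m)) (γ + 1) δ := by
  have hodd : ∀ a b : Z4, 2 * a ≠ 0 → 2 * b ≠ 0 → 2 * (a + b) = 0 := by decide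
  have hval : ∀ a b : Z4, a + a = 0 → 2 * b ≠ 0 → a = 0 ∨ a - 2 * b = 0 := by decide
  rw [mem_evenAt] at hcm
  refine isOfType_succ_of_coset (H := dualCode C) (g := unitWord m 2) ?_ ?_ ?_ ?_ ?_ hC
  · exact fun x hx v hv => hx v hv.1
  · intro v hv
    rw [addInner_unitWord_left]
    exact hv.2
  · intro h
    have := h c hc
    rw [addInner_unitWord_left] at this
    exact hcm this
  · rw [← unitWord_add, show (2 : Z4) + 2 = 0 by decide]
    simp [unitWord]
  · intro x hx
    have h2 : addInner x c + addInner x c = 0 := by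
      rw [← addInner_add_right]
      exact hx _ ⟨C.add_mem hc hc, hodd _ _ hcm hcm⟩
    have key : ∀ y ∈ dualCode (C ⊓ evenAt m), addInner y c = 0 → y ∈ dualCode C := by
      intro y hy hyc v hv
      by_cases hvm : v ∈ evenAt m
      · exact hy v ⟨hv, hvm⟩
      · have := hy (v + c) ⟨C.add_mem hv hc, hodd _ _ hvm hcm⟩
        rwa [addInner_add_right, hyc, add_zero] at this
    rcases hval _ _ h2 hcm with h | h
    · exact Or.inl (key x hx h)
    · refine Or.inr (key _ ((dualCode _).sub_mem hx fun v hv => ?_) ?_)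
      · rw [addInner_unitWord_left]
        exact hv.2
      · rw [addInner_sub_left, addInner_unitWord_left]
        exact h

/-! ### Parity in perfect codes -/

/-- In a finite abelian group, translating by an element of a symmetric sum-free set that has half
the size of the group exchanges the set with its complement. -/
lemma add_mem_iff_of_sum_free {G : Type*} [AddCommGroup G] [Finite G] {S : Set G}
    (hcard : 2 * Nat.card S = Nat.card G) (hneg : ∀ a ∈ S, -a ∈ S)
    (hfree : ∀ a ∈ S, ∀ b ∈ S, a + b ∉ S) {a : G} (ha : a ∈ S) (g : G) :
    g + a ∈ S ↔ g ∉ S := by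
  refine ⟨fun h hg => hfree g hg a ha h, fun hg => ?_⟩
  have hdisj : Disjoint S ((· + -a) '' S) := by
    rw [Set.disjoint_left]
    rintro x hx ⟨y, hy, rfl⟩
    exact hfree y hy (-a) (hneg a ha) hx
  have hc : (S ∪ (· + -a) '' S).ncard = Nat.card G := by
    rw [Set.ncard_union_eq hdisj (Set.toFinite _) (Set.toFinite _),
      Set.ncard_image_of_injective _ (add_left_injective _), ← hcard, Nat.card_coe_set_eq, two_mul]
  have huniv : S ∪ (· + -a) '' S = Set.univ := by
    rw [Set.eq_univ_iff_ncard, hc]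
  rcases (huniv ▸ Set.mem_univ g : g ∈ S ∪ (· + -a) '' S) with h | ⟨y, hy, rfl⟩
  · exact absurd h hg
  · simpa using hy

lemma two_mul_sum_eq_zero_of_add_self_mem {t n : ℕ} {C : AddSubgroup (Amb 0 n)}
    (hC : isQuatPerfect t n C) {y : Amb 0 n} (hy : y + y ∈ C) : 2 * ∑ i, y.2 i = 0 := by
  obtain ⟨ht, hn, hcard, hmin, -⟩ := (isQuatPerfect_iff C).1 hC
  have hsmall : ∀ x ∈ C, leeWeight x ≤ 3 → x = 0 := fun x hx h => by
    by_contra h0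
    have := hmin x hx h0
    omega
  have hleeunit : ∀ s : Z4ˣ, lee (s : Z4) = 1 := by decide
  let π : Amb 0 n →+ Amb 0 n ⧸ C := QuotientAddGroup.mk' C
  have hπ : ∀ x y : Amb 0 n, π x = π y ↔ x - y ∈ C := fun x y => by
    rw [← sub_eq_zero, ← map_sub]
    exact QuotientAddGroup.eq_zero_iff _
  let w : Fin n × Z4ˣ → Amb 0 n := fun p => unitWord p.1 p.2
  have hw : ∀ p, leeWeight (w p) = 1 := fun p => by
    rw [leeWeight_unitWord, hleeunit]
  have hwinj : Function.Injective w := by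
    rintro ⟨k, a⟩ ⟨l, b⟩ h
    have h' : (Pi.single k (a : Z4) : Fin n → Z4) = Pi.single l (b : Z4) := congrArg Prod.snd h
    by_cases hkl : k = l
    · subst hkl
      rw [Units.ext (Pi.single_injective (M := fun _ : Fin n => Z4) k h')]
    · have := congrFun h' k
      rw [Pi.single_eq_same, Pi.single_eq_of_ne hkl] at this
      have hne : ∀ a : Z4ˣ, (a : Z4) ≠ 0 := by decide
      exact absurd this (hne a)
  let S : Set (Amb 0 n ⧸ C) := Set.range (π ∘ w)
  have hinj : Function.Injective (π ∘ w) := by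
    intro p q h
    apply hwinj
    rw [← sub_eq_zero]
    refine hsmall _ ((hπ _ _).1 h) ?_
    rw [sub_eq_add_neg]
    refine (leeWeight_add_le _ _).trans ?_
    rw [leeWeight_neg, hw, hw]
    omega
  have hScard : 2 * Nat.card S = Nat.card (Amb 0 n ⧸ C) := by
    have h1 : Nat.card S = n * 2 := by
      rw [Nat.card_range_of_injective hinj, Nat.card_prod, Nat.card_fin, Nat.card_eq_fintype_card]
      congr 1
    have h2 := AddSubgroup.card_eq_card_quotient_mul_card_addSubgroup C
    rw [card_amb, hcard] at h2
    have hlt : t < 2 * n := by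
      have h3 : 2 * n = 2 ^ t := by
        rw [hn, ← pow_succ']
        congr 1
        omega
      rw [h3]
      exact Nat.lt_two_pow_self
    have h4 : 2 ^ (2 * n) = (4 * n) * 2 ^ (2 * n - t - 1) := by
      have : 4 * n = 2 ^ (t + 1) := by
        rw [hn, show t + 1 = 2 + (t - 1) by omega, pow_add]
        rfl
      rw [this, ← pow_add]
      congr 1
      omega
    have := Nat.eq_of_mul_eq_mul_right (by positivity) (h4.symm.trans h2)
    rw [h1, ← this]
    ring
  have hSneg : ∀ a ∈ S, -a ∈ S := by
    rintro _ ⟨p, rfl⟩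
    refine ⟨(p.1, -p.2), ?_⟩
    simp only [Function.comp_apply, ← map_neg]
    congr 1
    simp [w, unitWord, Pi.single_neg]
  have hfree : ∀ a ∈ S, ∀ b ∈ S, a + b ∉ S := by
    rintro _ ⟨p, rfl⟩ _ ⟨q, rfl⟩ ⟨r, h⟩
    simp only [Function.comp_apply, ← map_add] at h
    have h0 := hsmall _ ((hπ _ _).1 h) (by
      rw [sub_eq_add_neg]
      refine (leeWeight_add_le _ _).trans ?_
      have := leeWeight_add_le (w p) (w q)
      rw [leeWeight_neg]
      simp only [hw] at this ⊢
      omega)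
    have h1 := congrArg (fun x : Amb 0 n => ∑ i, x.2 i) (sub_eq_zero.1 h0)
    simp only [Prod.snd_add, Pi.add_apply, Finset.sum_add_distrib, w, sum_unitWord] at h1
    have : ∀ a b c : Z4ˣ, (c : Z4) ≠ a + b := by decide
    exact this _ _ _ h1
  have hstep : ∀ a ∈ S, ∀ g, g + a ∈ S ↔ g ∉ S := fun a ha g =>
    add_mem_iff_of_sum_free hScard hSneg hfree ha g
  have hparity : ∀ x : Amb 0 n, ∀ g, g + π x ∈ S ↔ (g ∈ S ↔ 2 * ∑ i, x.2 i = 0) := by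
    intro x
    rw [← sum_unitWord_eq x]
    refine Finset.sum_induction _
      (fun x : Amb 0 n => ∀ g, g + π x ∈ S ↔ (g ∈ S ↔ 2 * ∑ i, x.2 i = 0)) ?_ ?_ ?_
    · intro a b ha hb g
      have hab : ∀ a b : Z4, 2 * (a + b) = 0 ↔ (2 * a = 0 ↔ 2 * b = 0) := by decide
      rw [map_add, ← add_assoc, hb, ha]
      simp only [Prod.snd_add, Pi.add_apply, Finset.sum_add_distrib, hab]
      tauto
    · intro g
      simp
    · intro k _ g
      rw [sum_unitWord]
      generalize x.2 k = a
      have hone : ∀ g, g + π (unitWord k 1) ∈ S ↔ g ∉ S :=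
        hstep _ ⟨(k, 1), rfl⟩
      have hcases : ∀ a : Z4, a = 0 ∨ a = 1 ∨ a = 1 + 1 ∨ a = 1 + 1 + 1 := by decide
      have hz : unitWord k 0 = (0 : Amb 0 n) := by simp [unitWord]
      rcases hcases a with rfl | rfl | rfl | rfl
      · simp [hz]
      · rw [hone, show (2 : Z4) * 1 = 0 ↔ False by decide]
        tauto
      · rw [unitWord_add, map_add, ← add_assoc, hone, hone,
          show (2 : Z4) * (1 + 1) = 0 ↔ True by decide]
        tauto
      · rw [unitWord_add, unitWord_add, map_add, map_add, ← add_assoc, ← add_assoc, hone, hone,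
          hone, show (2 : Z4) * (1 + 1 + 1) = 0 ↔ False by decide]
        tauto
  have hdouble : ∀ p, w p + w p ∉ C := by
    intro p hp
    have h0 := hsmall _ hp (by
      have := leeWeight_add_le (w p) (w p)
      simp only [hw] at this
      omega)
    have h1 := congrArg (fun x : Amb 0 n => ∑ i, x.2 i) h0
    simp only [Prod.snd_add, Pi.add_apply, Finset.sum_add_distrib, w, sum_unitWord] at h1
    have : ∀ a : Z4ˣ, (a : Z4) + a ≠ 0 := by decide
    exact this _ (by simpa using h1)
  have h0S : (0 : Amb 0 n ⧸ C) ∉ S := by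
    rintro ⟨p, hp⟩
    have : w p ∈ C := (QuotientAddGroup.eq_zero_iff _).1 hp
    exact hdouble p (C.add_mem this this)
  by_contra hodd
  obtain ⟨p, hp⟩ : π y ∈ S := by
    have := (hparity y 0).2 (by tauto)
    rwa [zero_add] at this
  have h1 : w p - y ∈ C := (hπ _ _).1 hp
  have h2 : w p + w p = (w p - y) + (w p - y) + (y + y) := by abel
  exact hdouble p (h2 ▸ C.add_mem (C.add_mem h1 h1) hy)

/-! ### Doubled codes -/

section Doubling

variable {β n : ℕ}

/-- The sum of the two halves of a word, after multiplying its coordinates by the signs `s`. -/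
def foldWord (f : Fin β ⊕ Fin β ≃ Fin n) (s : Fin n → Z4ˣ) : Amb 0 n →+ Amb 0 β where
  toFun x := (0, fun i => s (f (.inl i)) * x.2 (f (.inl i)) + s (f (.inr i)) * x.2 (f (.inr i)))
  map_zero' := by ext i <;> simp
  map_add' x y := by
    refine Prod.ext (Subsingleton.elim _ _) (funext fun i => ?_)
    simp only [Prod.snd_add, Pi.add_apply]
    ring

/-- The doubling of `C`: its dual consists of the words `(h, h)` and `(h, h + 2)` with `h` in the
dual of `C`, up to the identification `f` of the coordinates and the signs `s`. -/
def doubleCode (f : Fin β ⊕ Fin β ≃ Fin n) (s : Fin n → Z4ˣ) (C : AddSubgroup (Amb 0 β)) :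
    AddSubgroup (Amb 0 n) where
  carrier := {x | foldWord f s x ∈ C ∧ 2 * ∑ i, x.2 (f (.inr i)) = 0}
  zero_mem' := by simp
  add_mem' := by
    rintro x y ⟨hx, hx'⟩ ⟨hy, hy'⟩
    refine ⟨?_, ?_⟩
    · rw [map_add]
      exact C.add_mem hx hy
    · simp only [Prod.snd_add, Pi.add_apply, Finset.sum_add_distrib, mul_add, hx', hy', add_zero]
  neg_mem' := by
    rintro x ⟨hx, hx'⟩
    refine ⟨?_, ?_⟩
    · rw [map_neg]
      exact C.neg_mem hx
    · simp only [Prod.snd_neg, Pi.neg_apply, Finset.sum_neg_distrib, mul_neg, hx', neg_zero]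

lemma mem_doubleCode {f : Fin β ⊕ Fin β ≃ Fin n} {s : Fin n → Z4ˣ} {C : AddSubgroup (Amb 0 β)}
    {x : Amb 0 n} :
    x ∈ doubleCode f s C ↔ foldWord f s x ∈ C ∧ 2 * ∑ i, x.2 (f (.inr i)) = 0 := Iff.rfl

lemma doubleCode_inf (f : Fin β ⊕ Fin β ≃ Fin n) (s : Fin n → Z4ˣ)
    (C C' : AddSubgroup (Amb 0 β)) :
    doubleCode f s C ⊓ doubleCode f s C' = doubleCode f s (C ⊓ C') := by
  ext x
  simp only [AddSubgroup.mem_inf, mem_doubleCode]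
  tauto

/-- The word with halves `u` and `v`, with its coordinates multiplied by the signs `s`. -/
def joinWord (f : Fin β ⊕ Fin β ≃ Fin n) (s : Fin n → Z4ˣ) (u v : Amb 0 β) : Amb 0 n :=
  (0, fun j => s j * Sum.elim u.2 v.2 (f.symm j))

@[simp]
lemma joinWord_inl (f : Fin β ⊕ Fin β ≃ Fin n) (s : Fin n → Z4ˣ) (u v : Amb 0 β) (i : Fin β) :
    (joinWord f s u v).2 (f (.inl i)) = s (f (.inl i)) * u.2 i := by
  simp [joinWord]

@[simp]
lemma joinWord_inr (f : Fin β ⊕ Fin β ≃ Fin n) (s : Fin n → Z4ˣ) (u v : Amb 0 β) (i : Fin β) :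
    (joinWord f s u v).2 (f (.inr i)) = s (f (.inr i)) * v.2 i := by
  simp [joinWord]

lemma amb_ext_halves (f : Fin β ⊕ Fin β ≃ Fin n) {x y : Amb 0 n}
    (hl : ∀ i, x.2 (f (.inl i)) = y.2 (f (.inl i)))
    (hr : ∀ i, x.2 (f (.inr i)) = y.2 (f (.inr i))) : x = y := by
  refine Prod.ext (Subsingleton.elim _ _) (funext fun j => ?_)
  obtain ⟨i | i, rfl⟩ := f.surjective j
  exacts [hl i, hr i]

lemma sum_halves {M : Type*} [AddCommMonoid M] (f : Fin β ⊕ Fin β ≃ Fin n) (F : Fin n → M) :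
    ∑ j, F j = ∑ i, F (f (.inl i)) + ∑ i, F (f (.inr i)) := by
  rw [← f.sum_comp, Fintype.sum_sum_type]

lemma foldWord_joinWord (f : Fin β ⊕ Fin β ≃ Fin n) (s : Fin n → Z4ˣ) (u v : Amb 0 β) :
    foldWord f s (joinWord f s u v) = u + v := by
  refine Prod.ext (Subsingleton.elim _ _) (funext fun i => ?_)
  simp [foldWord, unit_mul_unit_mul]

lemma joinWord_mem_doubleCode {f : Fin β ⊕ Fin β ≃ Fin n} {s : Fin n → Z4ˣ}
    {C : AddSubgroup (Amb 0 β)} {u v : Amb 0 β} :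
    joinWord f s u v ∈ doubleCode f s C ↔ u + v ∈ C ∧ 2 * ∑ i, v.2 i = 0 := by
  rw [mem_doubleCode, foldWord_joinWord]
  simp only [joinWord_inr, Finset.mul_sum, two_mul_unit_mul]

lemma joinWord_surjective (f : Fin β ⊕ Fin β ≃ Fin n) (s : Fin n → Z4ˣ) (x : Amb 0 n) :
    ∃ u v, joinWord f s u v = x :=
  ⟨(0, fun i => s (f (.inl i)) * x.2 (f (.inl i))), (0, fun i => s (f (.inr i)) * x.2 (f (.inr i))),
    amb_ext_halves f (by simp [unit_mul_unit_mul]) (by simp [unit_mul_unit_mul])⟩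

lemma joinWord_injective (f : Fin β ⊕ Fin β ≃ Fin n) (s : Fin n → Z4ˣ) {u v u' v' : Amb 0 β}
    (h : joinWord f s u v = joinWord f s u' v') : u = u' ∧ v = v' := by
  constructor
  · refine Prod.ext (Subsingleton.elim _ _) (funext fun i => ?_)
    have := congrArg (fun x : Amb 0 n => x.2 (f (.inl i))) h
    simpa using this
  · refine Prod.ext (Subsingleton.elim _ _) (funext fun i => ?_)
    have := congrArg (fun x : Amb 0 n => x.2 (f (.inr i))) h
    simpa using this

lemma leeWeight_joinWord (f : Fin β ⊕ Fin β ≃ Fin n) (s : Fin n → Z4ˣ) (u v : Amb 0 β) :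
    leeWeight (joinWord f s u v) = leeWeight u + leeWeight v := by
  simp only [leeWeight]
  rw [sum_halves f]
  simp only [joinWord_inl, joinWord_inr, lee_unit_mul]

lemma addInner_joinWord (f : Fin β ⊕ Fin β ≃ Fin n) (s : Fin n → Z4ˣ) (u v u' v' : Amb 0 β) :
    addInner (joinWord f s u v) (joinWord f s u' v') = addInner u u' + addInner v v' := by
  have h : ∀ (s : Z4ˣ) (a b : Z4), s * a * (s * b) = a * b := by decide
  simp only [addInner_eq_sum]
  rw [sum_halves f]
  simp only [joinWord_inl, joinWord_inr, h]

/-- The words with even coordinate sum. -/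
def evenSum (β : ℕ) : AddSubgroup (Amb 0 β) where
  carrier := {x | 2 * ∑ i, x.2 i = 0}
  zero_mem' := by simp
  add_mem' := by
    intro a b ha hb
    simp only [Set.mem_ofPred_eq, Prod.snd_add, Pi.add_apply, Finset.sum_add_distrib,
      mul_add] at ha hb ⊢
    rw [ha, hb, add_zero]
  neg_mem' := by
    intro a ha
    simp only [Set.mem_ofPred_eq, Prod.snd_neg, Pi.neg_apply, Finset.sum_neg_distrib,
      mul_neg] at ha ⊢
    rw [ha, neg_zero]

lemma mem_evenSum {x : Amb 0 β} : x ∈ evenSum β ↔ 2 * ∑ i, x.2 i = 0 := Iff.rfl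

lemma two_mul_card_evenSum (hβ : 0 < β) : 2 * Nat.card (evenSum β) = 2 ^ (2 * β) := by
  rw [← card_amb, ← AddSubgroup.card_top (G := Amb 0 β)]
  refine (card_eq_two_mul_of_coset (g := unitWord ⟨0, hβ⟩ 1) le_top trivial ?_ ?_).symm
  · rw [mem_evenSum, sum_unitWord]
    decide
  · intro x _
    have h : ∀ a : Z4, 2 * a = 0 ∨ 2 * (a - 1) = 0 := by decide
    simp only [mem_evenSum, Prod.snd_sub, Pi.sub_apply, Finset.sum_sub_distrib, sum_unitWord]
    exact h _

lemma two_mul_card_doubleCode (f : Fin β ⊕ Fin β ≃ Fin n) (s : Fin n → Z4ˣ)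
    (C : AddSubgroup (Amb 0 β)) (hβ : 0 < β) :
    2 * Nat.card (doubleCode f s C) = Nat.card C * 2 ^ (2 * β) := by
  have hbij : Function.Bijective (fun p : C × evenSum β =>
      (⟨joinWord f s (p.1 - p.2) p.2, joinWord_mem_doubleCode.2
        ⟨by rw [sub_add_cancel]; exact p.1.2, p.2.2⟩⟩ : doubleCode f s C)) := by
    constructor
    · rintro ⟨⟨c, hc⟩, ⟨v, hv⟩⟩ ⟨⟨c', hc'⟩, ⟨v', hv'⟩⟩ h
      obtain ⟨h1, h2⟩ := joinWord_injective f s (congrArg Subtype.val h)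
      simp only at h1 h2
      subst h2
      simpa using h1
    · rintro ⟨x, hx⟩
      obtain ⟨u, v, rfl⟩ := joinWord_surjective f s x
      obtain ⟨h1, h2⟩ := joinWord_mem_doubleCode.1 hx
      exact ⟨(⟨u + v, h1⟩, ⟨v, h2⟩), by simp⟩
  rw [← Nat.card_eq_of_bijective _ hbij, Nat.card_prod, ← two_mul_card_evenSum hβ]
  ring

lemma two_mul_sum_unitWord_add (k l : Fin β) :
    2 * ∑ i, (unitWord k 1 + unitWord l 1 : Amb 0 β).2 i = 0 := by
  simp only [Prod.snd_add, Pi.add_apply, Finset.sum_add_distrib, sum_unitWord]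
  decide

lemma isQuatPerfect_doubleCode {t : ℕ} (f : Fin β ⊕ Fin β ≃ Fin (2 * β))
    (s : Fin (2 * β) → Z4ˣ) {C : AddSubgroup (Amb 0 β)} (hC : isQuatPerfect t β C) :
    isQuatPerfect (t + 1) (2 * β) (doubleCode f s C) := by
  obtain ⟨ht, hβ, hcard, hmin, -⟩ := (isQuatPerfect_iff C).1 hC
  have hβt : 2 * β = 2 ^ t := by
    rw [hβ, ← pow_succ']
    congr 1
    omega
  have hlt : t < 2 * β := hβt ▸ Nat.lt_two_pow_self
  have hmin' : ∀ x ∈ doubleCode f s C, x ≠ 0 → 4 ≤ leeWeight x := by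
    intro x hx hx0
    obtain ⟨u, v, rfl⟩ := joinWord_surjective f s x
    obtain ⟨huv, hv⟩ := joinWord_mem_doubleCode.1 hx
    rw [leeWeight_joinWord]
    by_cases h0 : u + v = 0
    · obtain rfl := eq_neg_of_add_eq_zero_left h0
      have hv0 : leeWeight v ≠ 0 := by
        rw [Ne, leeWeight_eq_zero_iff]
        rintro rfl
        exact hx0 (amb_ext_halves f (by simp) (by simp))
      have h1 : leeWeight v ≠ 1 := by
        intro h
        rw [← two_mul_leeWeight, h] at hv
        exact absurd hv (by decide)
      rw [leeWeight_neg]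
      omega
    · exact (hmin _ huv h0).trans (leeWeight_add_le u v)
  refine (isQuatPerfect_iff _).2 ⟨by omega, hβt, ?_, hmin', ?_⟩
  · have h := two_mul_card_doubleCode f s C (by omega)
    rw [hcard, ← pow_add] at h
    refine Nat.eq_of_mul_eq_mul_left two_pos (h.trans ?_)
    rw [← pow_succ']
    congr 1
    omega
  · have hlee : lee 1 = 1 := by decide
    let k : Fin β := ⟨0, by omega⟩
    let l : Fin β := ⟨1, by omega⟩
    have hkl : k ≠ l := by simp [k, l]
    let v : Amb 0 β := unitWord k 1 + unitWord l 1
    have hv0 : v ≠ 0 := by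
      intro h
      have := congrFun (congrArg Prod.snd h) k
      simp only [v, unitWord, Prod.snd_add, Pi.add_apply, Pi.single_eq_same,
        Pi.single_eq_of_ne hkl] at this
      exact absurd this (show (1 : Z4) + 0 ≠ 0 by decide)
    have hv : leeWeight v ≤ 2 := (leeWeight_add_le _ _).trans (by
      rw [leeWeight_unitWord, leeWeight_unitWord, hlee])
    have hmem : joinWord f s (-v) v ∈ doubleCode f s C :=
      joinWord_mem_doubleCode.2 ⟨by simp, two_mul_sum_unitWord_add k l⟩
    have hne : joinWord f s (-v) v ≠ 0 := by
      rw [Ne, ← leeWeight_eq_zero_iff, leeWeight_joinWord]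
      have := (leeWeight_eq_zero_iff v).not.2 hv0
      omega
    refine ⟨_, hmem, hne, le_antisymm ?_ (hmin' _ hmem hne)⟩
    rw [leeWeight_joinWord, leeWeight_neg]
    omega

/-- The homomorphism `h ↦ (h, h)`, up to the identification `f` and the signs `s`. -/
def repeatWord (f : Fin β ⊕ Fin β ≃ Fin n) (s : Fin n → Z4ˣ) : Amb 0 β →+ Amb 0 n where
  toFun h := joinWord f s h h
  map_zero' := amb_ext_halves f (by simp) (by simp)
  map_add' x y := amb_ext_halves f (by simp [mul_add]) (by simp [mul_add])

lemma isOfType_dualCode_doubleCode {γ δ : ℕ} (f : Fin β ⊕ Fin β ≃ Fin n) (s : Fin n → Z4ˣ)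
    {C : AddSubgroup (Amb 0 β)} (hβ : 0 < β) (hC : isOfType (dualCode C) γ δ) :
    isOfType (dualCode (doubleCode f s C)) (γ + 1) δ := by
  let two : Amb 0 β := (0, fun _ => 2)
  have htwo : ∀ v, addInner two v = 2 * ∑ i, v.2 i := fun v => by
    rw [addInner_eq_sum, Finset.mul_sum]
  have hadd : ∀ u v u' v', joinWord f s u v + joinWord f s u' v' = joinWord f s (u + u') (v + v') :=
    fun u v u' v' => amb_ext_halves f (by simp [mul_add]) (by simp [mul_add])
  have hsub : ∀ u v u' v', joinWord f s u v - joinWord f s u' v' = joinWord f s (u - u') (v - v') :=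
    fun u v u' v' => amb_ext_halves f (by simp [mul_sub]) (by simp [mul_sub])
  have hzero : joinWord f s 0 0 = 0 := amb_ext_halves f (by simp) (by simp)
  have htwo2 : two + two = 0 :=
    Prod.ext (Subsingleton.elim _ _) (funext fun _ => show (2 : Z4) + 2 = 0 by decide)
  refine isOfType_succ_of_coset (H := (dualCode C).map (repeatWord f s))
    (g := joinWord f s 0 two) ?_ ?_ ?_ ?_ ?_
    (isOfType_map _ (fun x y h => (joinWord_injective f s h).1) hC)
  · rintro _ ⟨h, hh, rfl⟩ x hx
    obtain ⟨u, v, rfl⟩ := joinWord_surjective f s x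
    change addInner (joinWord f s h h) _ = 0
    rw [addInner_joinWord, ← addInner_add_right]
    exact hh _ (joinWord_mem_doubleCode.1 hx).1
  · intro x hx
    obtain ⟨u, v, rfl⟩ := joinWord_surjective f s x
    rw [addInner_joinWord, addInner_zero_left, zero_add, htwo]
    exact (joinWord_mem_doubleCode.1 hx).2
  · rintro ⟨h, -, hh⟩
    obtain ⟨h1, h2⟩ := joinWord_injective f s hh
    have := congrFun (congrArg Prod.snd (h1.symm.trans h2)) ⟨0, hβ⟩
    exact absurd this (show (0 : Z4) ≠ 2 by decide)
  · rw [hadd, add_zero, htwo2, hzero]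
  · intro x hx
    obtain ⟨a, b, rfl⟩ := joinWord_surjective f s x
    have ha : a ∈ dualCode C := by
      intro c hc
      have := hx (joinWord f s c 0) (joinWord_mem_doubleCode.2 ⟨by simpa using hc, by simp⟩)
      rw [addInner_joinWord] at this
      simpa [addInner_eq_sum] using this
    have hb : ∀ k l, b.2 k - a.2 k + (b.2 l - a.2 l) = 0 := by
      intro k l
      have := hx (joinWord f s (-(unitWord k 1 + unitWord l 1)) (unitWord k 1 + unitWord l 1))
        (joinWord_mem_doubleCode.2 ⟨by simp, two_mul_sum_unitWord_add k l⟩)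
      rw [addInner_joinWord] at this
      simp only [addInner_eq_sum, Prod.snd_neg, Pi.neg_apply, Prod.snd_add, Pi.add_apply, mul_neg,
        mul_add, Finset.sum_neg_distrib, Finset.sum_add_distrib] at this
      simp only [unitWord, Pi.single_apply, mul_ite, mul_one, mul_zero, Finset.sum_ite_eq',
        Finset.mem_univ, if_true] at this
      rw [← this]
      ring
    have hval : ∀ p q : Z4, p + p = 0 → p + q = 0 → q = p := by decide
    have hval' : ∀ p : Z4, p + p = 0 → p = 0 ∨ p = 2 := by decide
    let o : Fin β := ⟨0, hβ⟩
    have hconst : ∀ l, b.2 l - a.2 l = b.2 o - a.2 o := fun l => hval _ _ (hb o o) (hb o l)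
    rcases hval' _ (hb o o) with h | h
    · refine Or.inl ⟨a, ha, ?_⟩
      have : b = a := Prod.ext (Subsingleton.elim _ _)
        (funext fun l => sub_eq_zero.1 ((hconst l).trans h))
      rw [this]
      rfl
    · refine Or.inr ⟨a, ha, ?_⟩
      have : b - two = a := Prod.ext (Subsingleton.elim _ _)
        (funext fun l => by
          have h3 : b.2 l - a.2 l = 2 := (hconst l).trans h
          change b.2 l - 2 = a.2 l
          rw [← h3]
          ring)
      rw [hsub, sub_zero, this]
      rfl

/-- Exchanging the two copies of the coordinate `m`. -/
def swapAt (f : Fin β ⊕ Fin β ≃ Fin n) (m : Fin β) : Fin β ⊕ Fin β ≃ Fin n :=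
  (Equiv.swap (.inl m) (.inr m)).trans f

lemma mem_doubleCode_swapAt {f : Fin β ⊕ Fin β ≃ Fin n} {s : Fin n → Z4ˣ} {m : Fin β}
    {C : AddSubgroup (Amb 0 β)} {x : Amb 0 n} :
    x ∈ doubleCode (swapAt f m) s C ↔ foldWord f s x ∈ C ∧
      2 * (∑ i, x.2 (f (.inr i)) + (x.2 (f (.inl m)) + x.2 (f (.inr m)))) = 0 := by
  have hl : ∀ i ≠ m, swapAt f m (.inl i) = f (.inl i) := fun i hi => by
    simp [swapAt, Equiv.swap_apply_of_ne_of_ne, hi]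
  have hr : ∀ i ≠ m, swapAt f m (.inr i) = f (.inr i) := fun i hi => by
    simp [swapAt, Equiv.swap_apply_of_ne_of_ne, hi]
  have hlm : swapAt f m (.inl m) = f (.inr m) := by simp [swapAt]
  have hrm : swapAt f m (.inr m) = f (.inl m) := by simp [swapAt]
  have hfold : foldWord (swapAt f m) s x = foldWord f s x := by
    refine Prod.ext (Subsingleton.elim _ _) (funext fun i => ?_)
    by_cases hi : i = m
    · subst hi
      simp [foldWord, hlm, hrm, add_comm]
    · simp [foldWord, hl i hi, hr i hi]
  have hsum : 2 * ∑ i, x.2 (swapAt f m (.inr i)) =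
      2 * (∑ i, x.2 (f (.inr i)) + (x.2 (f (.inl m)) + x.2 (f (.inr m)))) := by
    rw [← Finset.add_sum_erase _ _ (Finset.mem_univ m),
      ← Finset.add_sum_erase _ (fun i => x.2 (f (.inr i))) (Finset.mem_univ m), hrm,
      Finset.sum_congr rfl fun i hi => by rw [hr i (Finset.ne_of_mem_erase hi)]]
    have : ∀ p q r : Z4, 2 * (p + q) = 2 * (r + q + (p + r)) := by decide
    exact this _ _ _
  rw [mem_doubleCode, hfold, hsum]

lemma foldWord_one_apply (f : Fin β ⊕ Fin β ≃ Fin n) (x : Amb 0 n) (i : Fin β) :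
    (foldWord f 1 x).2 i = x.2 (f (.inl i)) + x.2 (f (.inr i)) := by
  simp [foldWord]

lemma doubleCode_inf_doubleCode_swapAt (f : Fin β ⊕ Fin β ≃ Fin n) (m : Fin β)
    (C C' : AddSubgroup (Amb 0 β)) :
    doubleCode f 1 C ⊓ doubleCode (swapAt f m) 1 C' = doubleCode f 1 (C ⊓ C' ⊓ evenAt m) := by
  ext x
  rw [AddSubgroup.mem_inf, mem_doubleCode_swapAt, mem_doubleCode, mem_doubleCode,
    AddSubgroup.mem_inf, AddSubgroup.mem_inf, mem_evenAt, foldWord_one_apply,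
    mul_add 2 (∑ i, _)]
  constructor
  · rintro ⟨⟨h1, h2⟩, h3, h4⟩
    rw [h2, zero_add] at h4
    exact ⟨⟨⟨h1, h3⟩, h4⟩, h2⟩
  · rintro ⟨⟨⟨h1, h3⟩, h4⟩, h2⟩
    exact ⟨⟨h1, h2⟩, h3, by rw [h2, h4, add_zero]⟩

/-- The signs that are `-1` on the second copy of the coordinate `k` and `1` elsewhere. -/
def signAt (f : Fin β ⊕ Fin β ≃ Fin n) (k : Fin β) : Fin n → Z4ˣ :=
  Function.update 1 (f (.inr k)) (-1)

lemma foldWord_signAt (f : Fin β ⊕ Fin β ≃ Fin n) (k : Fin β) (x : Amb 0 n) :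
    foldWord f (signAt f k) x = foldWord f 1 x + unitWord k (2 * x.2 (f (.inr k))) := by
  refine Prod.ext (Subsingleton.elim _ _) (funext fun i => ?_)
  have h : ∀ a : Z4, -a = a + 2 * a := by decide
  by_cases hi : i = k
  · subst hi
    have := h (x.2 (f (.inr i)))
    simp [foldWord, signAt, unitWord, add_assoc, ← this]
  · simp [foldWord, signAt, unitWord, hi]

lemma doubleCode_inf_doubleCode_signAt {f : Fin β ⊕ Fin β ≃ Fin n} {k m : Fin β}
    {C C' : AddSubgroup (Amb 0 β)} (heven : ∀ c ∈ C ⊓ C', ∀ i, c ∈ evenAt i)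
    (hodd : ∀ c ∈ C, c + unitWord k 2 ∈ C' → c ∉ evenAt m) :
    doubleCode f 1 C ⊓ doubleCode (swapAt f m) (signAt f k) C' =
      doubleCode f 1 (C ⊓ C') ⊓ evenAt (f (.inr k)) := by
  have hval : ∀ a : Z4, 2 * a = 0 ∨ 2 * a = 2 := by decide
  have hz : unitWord k 0 = (0 : Amb 0 β) := by simp [unitWord]
  ext x
  rw [AddSubgroup.mem_inf, mem_doubleCode_swapAt, mem_doubleCode, AddSubgroup.mem_inf,
    mem_doubleCode, AddSubgroup.mem_inf, mem_evenAt, foldWord_signAt, mul_add 2 (∑ i, _),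
    ← foldWord_one_apply]
  constructor
  · rintro ⟨⟨h1, h2⟩, h3, h4⟩
    rw [h2, zero_add] at h4
    rcases hval (x.2 (f (.inr k))) with h | h
    · rw [h, hz, add_zero] at h3
      exact ⟨⟨⟨h1, h3⟩, h2⟩, h⟩
    · rw [h] at h3
      exact absurd h4 (hodd _ h1 h3)
  · rintro ⟨⟨⟨h1, h3⟩, h2⟩, h⟩
    refine ⟨⟨h1, h2⟩, ?_, ?_⟩
    · rwa [h, hz, add_zero]
    · rw [h2, zero_add]
      exact heven _ ⟨h1, h3⟩ m

end Doubling

/-- Half of a word with even coordinates. -/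
lemma exists_add_self_eq {n : ℕ} {c : Amb 0 n} (hc : ∀ i, c ∈ evenAt i) : ∃ y, y + y = c := by
  have h : ∀ a : Z4, 2 * a = 0 → ∃ b, b + b = a := by decide
  choose y hy using fun i => h _ (hc i)
  exact ⟨(0, y), Prod.ext (Subsingleton.elim _ _) (funext hy)⟩

/-- For perfect codes whose intersection has even coordinates only, the words of the first code
that become words of the second by adding `2` at `k` share an odd coordinate. -/
lemma exists_common_odd_coordinate {t n : ℕ} {C₁ C₂ : AddSubgroup (Amb 0 n)}
    (h₁ : isQuatPerfect t n C₁) (h₂ : isQuatPerfect t n C₂)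
    (heven : ∀ c ∈ C₁ ⊓ C₂, ∀ i, c ∈ evenAt i) (k : Fin n) :
    ∃ m, ∀ c ∈ C₁, c + unitWord k 2 ∈ C₂ → c ∉ evenAt m := by
  by_contra! hcon
  obtain ⟨c, hc₁, hc₂, -⟩ := hcon k
  have hc : ∀ i, c ∈ evenAt i := by
    intro i
    obtain ⟨d, hd₁, hd₂, hd⟩ := hcon i
    have h := heven (c - d) ⟨C₁.sub_mem hc₁ hd₁, by
      rw [← add_sub_add_right_eq_sub c d (unitWord k 2)]
      exact C₂.sub_mem hc₂ hd₂⟩ i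
    simpa using (evenAt i).add_mem h hd
  obtain ⟨y, rfl⟩ := exists_add_self_eq hc
  have e₁ := two_mul_sum_eq_zero_of_add_self_mem h₁ hc₁
  have e₂ := two_mul_sum_eq_zero_of_add_self_mem h₂ (y := y + unitWord k 1) (by
    rw [add_add_add_comm, ← unitWord_add, one_add_one_eq_two]
    exact hc₂)
  simp only [Prod.snd_add, Pi.add_apply, Finset.sum_add_distrib, sum_unitWord, mul_add, e₁] at e₂
  exact absurd e₂ (by decide)

/-- doubling construction for the `γ` parameter of the intersection's
dual type. -/
theorem stmt8 {t β γ₁ δ₁ γ₂ δ₂ i j : ℕ} (ht : 3 ≤ t) (hβ : β = 2 ^ (t - 1))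
    (C₁ C₂ : AddSubgroup (Amb 0 β))
    (h₁ : isQuatPerfect t β C₁) (h₂ : isQuatPerfect t β C₂)
    (hd₁ : isOfType (dualCode C₁) γ₁ δ₁) (hd₂ : isOfType (dualCode C₂) γ₂ δ₂)
    (hint : isOfType (dualCode (C₁ ⊓ C₂)) i j) :
    ∀ i' ∈ ({i + 1, i + 2} : Set ℕ),
      ∃ D₁ D₂ : AddSubgroup (Amb 0 (2 * β)),
        isQuatPerfect (t + 1) (2 * β) D₁ ∧ isQuatPerfect (t + 1) (2 * β) D₂ ∧
        isOfType (dualCode D₁) (γ₁ + 1) δ₁ ∧ isOfType (dualCode D₂) (γ₂ + 1) δ₂ ∧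
        isOfType (dualCode (D₁ ⊓ D₂)) i' j := by
  have hβ2 : 2 ≤ β := by
    rw [hβ]
    exact Nat.le_self_pow (by omega) 2
  let f : Fin β ⊕ Fin β ≃ Fin (2 * β) := finSumFinEquiv.trans (finCongr (two_mul β).symm)
  rintro i' (rfl | rfl)
  · refine ⟨doubleCode f 1 C₁, doubleCode f 1 C₂, isQuatPerfect_doubleCode f 1 h₁,
      isQuatPerfect_doubleCode f 1 h₂, isOfType_dualCode_doubleCode f 1 (by omega) hd₁,
      isOfType_dualCode_doubleCode f 1 (by omega) hd₂, ?_⟩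
    rw [doubleCode_inf]
    exact isOfType_dualCode_doubleCode f 1 (by omega) hint
  · by_cases heven : ∀ c ∈ C₁ ⊓ C₂, ∀ i, c ∈ evenAt i
    · let k : Fin β := ⟨0, by omega⟩
      let l : Fin β := ⟨1, by omega⟩
      obtain ⟨m, hm⟩ := exists_common_odd_coordinate h₁ h₂ heven k
      refine ⟨doubleCode f 1 C₁, doubleCode (swapAt f m) (signAt f k) C₂,
        isQuatPerfect_doubleCode f 1 h₁, isQuatPerfect_doubleCode _ _ h₂,
        isOfType_dualCode_doubleCode f 1 (by omega) hd₁,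
        isOfType_dualCode_doubleCode _ _ (by omega) hd₂, ?_⟩
      rw [doubleCode_inf_doubleCode_signAt heven hm]
      refine isOfType_dualCode_inf_evenAt
        (c := joinWord f 1 (-(unitWord k 1 + unitWord l 1)) (unitWord k 1 + unitWord l 1))
        (joinWord_mem_doubleCode.2 ⟨?_, two_mul_sum_unitWord_add k l⟩) ?_
        (isOfType_dualCode_doubleCode f 1 (by omega) hint)
      · rw [neg_add_cancel]
        exact zero_mem _
      · have hkl : k ≠ l := by simp [k, l]
        rw [mem_evenAt, joinWord_inr]
        simp only [unitWord, Prod.snd_add, Pi.add_apply, Pi.single_eq_same,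
          Pi.single_eq_of_ne hkl, Pi.one_apply, Units.val_one]
        decide
    · push Not at heven
      obtain ⟨c, hc, m, hm⟩ := heven
      refine ⟨doubleCode f 1 C₁, doubleCode (swapAt f m) 1 C₂,
        isQuatPerfect_doubleCode f 1 h₁, isQuatPerfect_doubleCode _ _ h₂,
        isOfType_dualCode_doubleCode f 1 (by omega) hd₁,
        isOfType_dualCode_doubleCode _ _ (by omega) hd₂, ?_⟩
      rw [doubleCode_inf_doubleCode_swapAt]
      exact isOfType_dualCode_doubleCode f 1 (by omega) (isOfType_dualCode_inf_evenAt hc hm hint)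
end
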